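/- arXiv:2205.00588 — 3 statements merged into one kernel-verified Lean document; each statement's English description precedes it below -/
import Mathlib

section
/- Fix integers k ≥ 1 and n > k. Then inf{DP(I)/Proph(I) : I an instance with k slots, n agents, any number m of types, and Proph(I) > 0} equals the infimum over all m ≥ 1 and all type distributions G over m types for n agents of innerLP^{DP/Proph}_{k,n}(G); and inf{DP(I)/ExAnte(I) : I an instance with k slots, n agents, any m, and ExAnte(I) > 0} equals the infimum over all m and G of innerLP^{DP/ExAnte}_{k,n}(G). -/
open Finset

/-- The polytope `P(k,n)` of state/acceptance probability vectors. -/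
def memP (k n : ℕ) (x y : ℕ → ℕ → ℝ) : Prop :=
  x 1 k = 1 ∧
  (∀ l, 1 ≤ l → l < k → x 1 l = 0) ∧
  (∀ i ∈ Finset.Icc 2 n, ∀ l ∈ Finset.Icc 1 k,
    x i l = x (i-1) l - y (i-1) l + (if l < k then y (i-1) (l+1) else 0)) ∧
  (∀ i ∈ Finset.Icc 1 n, ∀ l ∈ Finset.Icc 1 k, 0 ≤ y i l ∧ y i l ≤ x i l)

/-- `G` is a valid family of type distributions over `m` types for `n` agents. -/
def IsTypeDist (n m : ℕ) (G : ℕ → ℕ → ℝ) : Prop :=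
  ∀ i ∈ Finset.Icc 1 n, G i 0 = 0 ∧ G i m = 1 ∧ ∀ j ∈ Finset.Icc 1 m, G i (j-1) ≤ G i j

/-- `E[min{X_1+...+X_t, k}]` for independent Bernoulli `X_i` with success probabilities `p i`. -/
noncomputable def eMinBer (p : ℕ → ℝ) (t k : ℕ) : ℝ :=
  ∑ S ∈ (Finset.Icc 1 t).powerset,
    (∏ i ∈ S, p i) * (∏ i ∈ Finset.Icc 1 t \ S, (1 - p i)) * min (S.card : ℝ) (k : ℝ)

noncomputable def QProph (k n : ℕ) (G : ℕ → ℕ → ℝ) (j : ℕ) : ℝ :=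
  eMinBer (fun i => G i j) n k

noncomputable def QExAnte (k n : ℕ) (G : ℕ → ℕ → ℝ) (j : ℕ) : ℝ :=
  min (∑ i ∈ Finset.Icc 1 n, G i j) (k : ℝ)

noncomputable def coverSum (k n : ℕ) (G : ℕ → ℕ → ℝ) (j : ℕ) (x y : ℕ → ℕ → ℝ) : ℝ :=
  ∑ i ∈ Finset.Icc 1 n, ∑ l ∈ Finset.Icc 1 k, min (y i l) (G i j * x i l)

/-- The simplified dual LP `innerLP^{DP/·}_{k,n}(G)` with coefficients `Q`. -/
noncomputable def innerLP_DP (k n m : ℕ) (G : ℕ → ℕ → ℝ) (Q : ℕ → ℝ) : ℝ :=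
  sSup {θ : ℝ | ∃ x y, memP k n x y ∧ ∀ j ∈ Finset.Icc 1 m, θ * Q j ≤ coverSum k n G j x y}

/-- Prophet's value on realized valuations `v`. -/
noncomputable def prophVal (n k : ℕ) (v : Fin n → ℝ) : ℝ :=
  sSup {s : ℝ | ∃ S : Finset (Fin n), S.card ≤ k ∧ s = ∑ i ∈ S, v i}

/-- Expected prophet value on the instance given by valuations `r` and probabilities `p`. -/
noncomputable def Proph (k n m : ℕ) (r : ℕ → ℝ) (p : ℕ → ℕ → ℝ) : ℝ :=
  ∑ t ∈ Fintype.piFinset (fun _ : Fin n => Finset.Icc 1 m),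
    (∏ i : Fin n, p (i.1+1) (t i)) * prophVal n k (fun i => r (t i))

/-- The ex-ante relaxation of the instance given by `r` and `p`. -/
noncomputable def ExAnte (k n m : ℕ) (r : ℕ → ℝ) (p : ℕ → ℕ → ℝ) : ℝ :=
  sSup {s : ℝ | ∃ a : ℕ → ℝ,
    (∀ j ∈ Finset.Icc 1 m, 0 ≤ a j ∧ a j ≤ ∑ i ∈ Finset.Icc 1 n, p i j) ∧
    (∑ j ∈ Finset.Icc 1 m, a j ≤ (k : ℝ)) ∧
    s = ∑ j ∈ Finset.Icc 1 m, r j * a j}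

/-- DP value-to-go: `dpW n m r p d l = V_{n+1-d}^l` (so `V_{n+1}^l = 0`, `V_i^0 = 0`, and
`V_i^l = V_{i+1}^l + Σ_j p_{ij}·max{0, r_j - (V_{i+1}^l - V_{i+1}^{l-1})}`). -/
noncomputable def dpW (n m : ℕ) (r : ℕ → ℝ) (p : ℕ → ℕ → ℝ) : ℕ → ℕ → ℝ
  | 0 => fun _ => 0
  | (d+1) => fun l =>
      if l = 0 then 0 else
        dpW n m r p d l + ∑ j ∈ Finset.Icc 1 m,
          p (n - d) j * max 0 (r j - (dpW n m r p d l - dpW n m r p d (l-1)))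

/-- `DP(I) = V_1^k`. -/
noncomputable def DPval (k n m : ℕ) (r : ℕ → ℝ) (p : ℕ → ℕ → ℝ) : ℝ := dpW n m r p n k

/-- Valuations `r` are admissible for `m` types: `r_1 ≥ ... ≥ r_m ≥ 0`. -/
def IsValuation (m : ℕ) (r : ℕ → ℝ) : Prop :=
  (∀ j, 1 ≤ j → j < m → r (j+1) ≤ r j) ∧ 0 ≤ r m

/-- Probabilities `p` are admissible for `n` agents over `m` types. -/
def IsProb (n m : ℕ) (p : ℕ → ℕ → ℝ) : Prop :=
  (∀ i ∈ Finset.Icc 1 n, ∀ j ∈ Finset.Icc 1 m, 0 ≤ p i j) ∧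
  (∀ i ∈ Finset.Icc 1 n, ∑ j ∈ Finset.Icc 1 m, p i j = 1)


/-- Increments of the valuations, with `r_{m+1} = 0`. -/
noncomputable def Dl (m : ℕ) (r : ℕ → ℝ) (j : ℕ) : ℝ :=
  (if j ≤ m then r j else 0) - (if j + 1 ≤ m then r (j+1) else 0)

lemma abel_aux (s a : ℕ → ℝ) (M : ℕ) :
    ∑ j ∈ Icc 1 M, (s j - s (j+1)) * ∑ j' ∈ Icc 1 j, a j'
      = ∑ j ∈ Icc 1 M, s j * a j - s (M+1) * ∑ j' ∈ Icc 1 M, a j' := by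
  induction M with
  | zero => simp
  | succ M ih =>
    rw [Finset.sum_Icc_succ_top (by omega), ih, Finset.sum_Icc_succ_top (by omega),
      Finset.sum_Icc_succ_top (by omega)]
    ring

lemma abel (m : ℕ) (r a : ℕ → ℝ) :
    ∑ j ∈ Icc 1 m, Dl m r j * ∑ j' ∈ Icc 1 j, a j' = ∑ j ∈ Icc 1 m, r j * a j := by
  have h := abel_aux (fun j => if j ≤ m then r j else 0) a m
  simp only [Dl]
  rw [h]
  simp only [show ¬ (m + 1 ≤ m) by omega, if_false, zero_mul, sub_zero]
  apply Finset.sum_congr rfl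
  intro j hj
  rw [if_pos (Finset.mem_Icc.1 hj).2]

lemma Dl_nonneg {m : ℕ} {r : ℕ → ℝ} (hr : IsValuation m r) {j : ℕ} (hj : j ∈ Icc 1 m) :
    0 ≤ Dl m r j := by
  obtain ⟨h1, h2⟩ := Finset.mem_Icc.1 hj
  unfold Dl
  rw [if_pos h2]
  split_ifs with h
  · have := hr.1 j h1 (by omega); linarith
  · have : j = m := by omega
    subst this; have := hr.2; linarith

/-- Value-to-go indexed by agents. -/
noncomputable def Vf (n m : ℕ) (r : ℕ → ℝ) (p : ℕ → ℕ → ℝ) (i l : ℕ) : ℝ :=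
  dpW n m r p (n + 1 - i) l

lemma Vf_zero (n m : ℕ) (r : ℕ → ℝ) (p : ℕ → ℕ → ℝ) (i : ℕ) : Vf n m r p i 0 = 0 := by
  unfold Vf
  cases n + 1 - i <;> simp [dpW]

lemma Vf_last (n m : ℕ) (r : ℕ → ℝ) (p : ℕ → ℕ → ℝ) (l : ℕ) : Vf n m r p (n+1) l = 0 := by
  simp [Vf, dpW]

lemma Vf_rec (n m : ℕ) (r : ℕ → ℝ) (p : ℕ → ℕ → ℝ) (i l : ℕ) (h2 : i ≤ n)
    (hl : 1 ≤ l) : Vf n m r p i l = Vf n m r p (i+1) l + ∑ j ∈ Icc 1 m,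
      p i j * max 0 (r j - (Vf n m r p (i+1) l - Vf n m r p (i+1) (l-1))) := by
  unfold Vf
  have e1 : n + 1 - i = (n - i) + 1 := by omega
  have e2 : n + 1 - (i+1) = n - i := by omega
  have e3 : n - (n - i) = i := by omega
  rw [e1, e2, dpW]
  simp only [e3]
  rw [if_neg (by omega)]

/-- relation between `G` and `p` -/
def GRel (n m : ℕ) (p G : ℕ → ℕ → ℝ) : Prop :=
  ∀ i ∈ Icc 1 n, ∀ j, j ≤ m → G i j = ∑ j' ∈ Icc 1 j, p i j'

lemma sum_incr (F : ℕ → ℝ) (h0 : F 0 = 0) (j : ℕ) :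
    ∑ j' ∈ Icc 1 j, (F j' - F (j'-1)) = F j := by
  induction j with
  | zero => simp [h0]
  | succ j ih => rw [Finset.sum_Icc_succ_top (by omega), ih]; simp

lemma step_le {m : ℕ} {r : ℕ → ℝ} (p G : ℕ → ℝ)
    (hp : ∀ j ∈ Icc 1 m, 0 ≤ p j) (hs : ∑ j ∈ Icc 1 m, p j = 1)
    (hG : ∀ j, j ≤ m → G j = ∑ j' ∈ Icc 1 j, p j') (x y c : ℝ) (hy : 0 ≤ y) (hyx : y ≤ x) :
    ∑ j ∈ Icc 1 m, Dl m r j * min y (G j * x)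
      ≤ c * y + x * ∑ j ∈ Icc 1 m, p j * max 0 (r j - c) := by
  have hx : 0 ≤ x := hy.trans hyx
  set F : ℕ → ℝ := fun j => min y (G j * x) with hF
  have F0 : F 0 = 0 := by simp [hF, hG 0 (by omega), hy]
  have Fm : F m = y := by simp [hF, hG m le_rfl, hs, hyx]
  have h1 : ∑ j ∈ Icc 1 m, Dl m r j * min y (G j * x)
      = ∑ j ∈ Icc 1 m, r j * (F j - F (j-1)) := by
    rw [← abel m r (fun j => F j - F (j-1))]
    apply Finset.sum_congr rfl
    intro j _
    rw [sum_incr F F0]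
  have h2 : ∑ j ∈ Icc 1 m, (F j - F (j-1)) = y := by rw [sum_incr F F0, Fm]
  have h3 : ∑ j ∈ Icc 1 m, r j * (F j - F (j-1))
      = c * y + ∑ j ∈ Icc 1 m, (r j - c) * (F j - F (j-1)) := by
    rw [← h2, Finset.mul_sum, ← Finset.sum_add_distrib]
    apply Finset.sum_congr rfl
    intros; ring
  rw [h1, h3, Finset.mul_sum]
  apply add_le_add le_rfl
  apply Finset.sum_le_sum
  intro j hj
  obtain ⟨hj1, hj2⟩ := Finset.mem_Icc.1 hj
  have hpj := hp j hj
  have hGj : G j = G (j-1) + p j := by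
    rw [hG j hj2, hG (j-1) (by omega)]
    obtain ⟨t, rfl⟩ : ∃ t, j = t + 1 := ⟨j-1, by omega⟩
    rw [Finset.sum_Icc_succ_top (by omega)]; simp
  have hpx : 0 ≤ p j * x := mul_nonneg hpj hx
  have hd0 : 0 ≤ F j - F (j-1) := by
    simp only [hF, hGj, sub_nonneg]
    apply min_le_min le_rfl; nlinarith
  have hd1 : F j - F (j-1) ≤ p j * x := by
    simp only [hF, hGj]
    rcases le_total y (G (j-1) * x) with h | h
    · rw [min_eq_left h, min_eq_left (by nlinarith)]; linarith
    · rw [min_eq_right h]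
      have := min_le_right y ((G (j-1) + p j) * x)
      nlinarith
  calc (r j - c) * (F j - F (j-1)) ≤ max 0 (r j - c) * (F j - F (j-1)) :=
        mul_le_mul_of_nonneg_right (le_max_right _ _) hd0
    _ ≤ max 0 (r j - c) * (p j * x) := mul_le_mul_of_nonneg_left hd1 (le_max_left _ _)
    _ = x * (p j * max 0 (r j - c)) := by ring

lemma step_ge {m : ℕ} {r : ℕ → ℝ} (hr : IsValuation m r) (p G : ℕ → ℝ)
    (hp : ∀ j ∈ Icc 1 m, 0 ≤ p j)
    (hG : ∀ j, j ≤ m → G j = ∑ j' ∈ Icc 1 j, p j') (x c ρ : ℝ) (hx : 0 ≤ x)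
    (hρ : ρ = ∑ j ∈ Icc 1 m, if c < r j then p j else 0) :
    c * (x * ρ) + x * ∑ j ∈ Icc 1 m, p j * max 0 (r j - c) ≤
    ∑ j ∈ Icc 1 m, Dl m r j * min (x * ρ) (G j * x) := by
  set q : ℕ → ℝ := fun j => if c < r j then p j else 0 with hq
  have hqp : ∀ j ∈ Icc 1 m, 0 ≤ q j ∧ q j ≤ p j := by
    intro j hj
    have := hp j hj
    simp only [hq]; split_ifs <;> constructor <;> linarith
  have h1 : c * ρ + ∑ j ∈ Icc 1 m, p j * max 0 (r j - c) = ∑ j ∈ Icc 1 m, r j * q j := by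
    rw [hρ, Finset.mul_sum, ← Finset.sum_add_distrib]
    apply Finset.sum_congr rfl
    intro j _
    simp only [hq]
    split_ifs with h
    · rw [max_eq_right (by linarith)]; ring
    · rw [max_eq_left (by linarith)]; ring
  have h2 : c * (x * ρ) + x * ∑ j ∈ Icc 1 m, p j * max 0 (r j - c)
      = ∑ j ∈ Icc 1 m, Dl m r j * (x * ∑ j' ∈ Icc 1 j, q j') := by
    have : c * (x * ρ) + x * ∑ j ∈ Icc 1 m, p j * max 0 (r j - c)
      = x * (c * ρ + ∑ j ∈ Icc 1 m, p j * max 0 (r j - c)) := by ring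
    rw [this, h1, ← abel, Finset.mul_sum]
    apply Finset.sum_congr rfl
    intros; ring
  rw [h2]
  apply Finset.sum_le_sum
  intro j hj
  obtain ⟨hj1, hj2⟩ := Finset.mem_Icc.1 hj
  apply mul_le_mul_of_nonneg_left _ (Dl_nonneg hr hj)
  have hsub : Icc 1 j ⊆ Icc 1 m := Finset.Icc_subset_Icc le_rfl hj2
  apply le_min
  · apply mul_le_mul_of_nonneg_left _ hx
    rw [hρ]
    exact Finset.sum_le_sum_of_subset_of_nonneg hsub (fun i hi _ => (hqp i hi).1)
  · rw [mul_comm, hG j hj2]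
    apply mul_le_mul_of_nonneg_right _ hx
    exact Finset.sum_le_sum (fun i hi => (hqp i (hsub hi)).2)

/-- potential -/
noncomputable def Phi (k n m : ℕ) (r : ℕ → ℝ) (p x : ℕ → ℕ → ℝ) (i : ℕ) : ℝ :=
  ∑ l ∈ Icc 1 k, x i l * Vf n m r p i l

lemma shift_sum (k : ℕ) (f W : ℕ → ℝ) (hW : W 0 = 0) :
    ∑ l ∈ Icc 1 k, (if l < k then f (l+1) else 0) * W l = ∑ l ∈ Icc 1 k, f l * W (l-1) := by
  have h : ∀ K, ∑ l ∈ Icc 1 K, f (l+1) * W l = ∑ l ∈ Icc 1 (K+1), f l * W (l-1) := by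
    intro K
    induction K with
    | zero => simp [hW]
    | succ K ih => rw [Finset.sum_Icc_succ_top (by omega), ih,
        Finset.sum_Icc_succ_top (b := K+1) (by omega)]; simp
  cases k with
  | zero => simp
  | succ K =>
    rw [← h, Finset.sum_Icc_succ_top (by omega)]
    simp only [lt_irrefl, if_false, zero_mul, add_zero]
    apply Finset.sum_congr rfl
    intro l hl
    rw [if_pos (by have := (Finset.mem_Icc.1 hl).2; omega)]

/-- One step of the potential, assuming the flow equation for `i+1`. -/
lemma Phi_step (k n m : ℕ) (r : ℕ → ℝ) (p x y : ℕ → ℕ → ℝ) (i : ℕ) (h2 : i ≤ n)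
    (hxy : i < n → ∀ l ∈ Icc 1 k, x (i+1) l = x i l - y i l + (if l < k then y i (l+1) else 0)) :
    Phi k n m r p x i - Phi k n m r p x (i+1) = ∑ l ∈ Icc 1 k,
      ((Vf n m r p (i+1) l - Vf n m r p (i+1) (l-1)) * y i l + x i l * ∑ j ∈ Icc 1 m,
      p i j * max 0 (r j - (Vf n m r p (i+1) l - Vf n m r p (i+1) (l-1)))) := by
  have e1 : Phi k n m r p x (i+1) = ∑ l ∈ Icc 1 k, (x i l * Vf n m r p (i+1) l
      - y i l * Vf n m r p (i+1) l + y i l * Vf n m r p (i+1) (l-1)) := by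
    rw [Finset.sum_add_distrib, ← shift_sum k (y i) (Vf n m r p (i+1)) (Vf_zero _ _ _ _ _),
      ← Finset.sum_add_distrib]
    unfold Phi
    apply Finset.sum_congr rfl
    intro l hl
    rcases lt_or_eq_of_le h2 with h | h
    · rw [hxy h l hl]; ring
    · subst h; simp [Vf_last]
  rw [e1]
  unfold Phi
  rw [← Finset.sum_sub_distrib]
  apply Finset.sum_congr rfl
  intro l hl
  rw [Vf_rec n m r p i l h2 (Finset.mem_Icc.1 hl).1]
  ring

lemma Phi_tel (k n m : ℕ) (hk : 1 ≤ k) (r : ℕ → ℝ) (p x : ℕ → ℕ → ℝ) (h1 : x 1 k = 1)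
    (h2 : ∀ l, 1 ≤ l → l < k → x 1 l = 0) :
    ∑ i ∈ Icc 1 n, (Phi k n m r p x i - Phi k n m r p x (i+1)) = DPval k n m r p := by
  have h : ∀ N, ∑ i ∈ Icc 1 N, (Phi k n m r p x i - Phi k n m r p x (i+1))
      = Phi k n m r p x 1 - Phi k n m r p x (N+1) := by
    intro N
    induction N with
    | zero => simp
    | succ N ih => rw [Finset.sum_Icc_succ_top (by omega), ih]; ring
  rw [h]
  have e : Phi k n m r p x (n+1) = 0 := by simp [Phi, Vf_last]
  have e' : Phi k n m r p x 1 = Vf n m r p 1 k := by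
    unfold Phi
    rw [Finset.sum_eq_single k]
    · rw [h1, one_mul]
    · intro l hl hne
      obtain ⟨a, b⟩ := Finset.mem_Icc.1 hl
      rw [h2 l a (by omega), zero_mul]
    · intro h; exact absurd (Finset.mem_Icc.2 ⟨hk, le_rfl⟩) h
  rw [e, e', sub_zero]; simp [Vf, DPval]

lemma cov_swap (k n m : ℕ) (w : ℕ → ℝ) (G x y : ℕ → ℕ → ℝ) :
    ∑ j ∈ Icc 1 m, w j * coverSum k n G j x y
      = ∑ i ∈ Icc 1 n, ∑ l ∈ Icc 1 k, ∑ j ∈ Icc 1 m, w j * min (y i l) (G i j * x i l) := by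
  simp only [coverSum, Finset.mul_sum]
  rw [Finset.sum_comm]
  apply Finset.sum_congr rfl
  intro i _
  rw [Finset.sum_comm]

lemma DP_ge {k n m : ℕ} (hk : 1 ≤ k) {r : ℕ → ℝ} {p G x y : ℕ → ℕ → ℝ}
    (hp : IsProb n m p) (hG : GRel n m p G) (hxy : memP k n x y) :
    ∑ j ∈ Icc 1 m, Dl m r j * coverSum k n G j x y ≤ DPval k n m r p := by
  obtain ⟨a, b, c, d⟩ := hxy
  rw [← Phi_tel k n m hk r p x a b, cov_swap]
  apply Finset.sum_le_sum
  intro i hi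
  obtain ⟨i1, i2⟩ := Finset.mem_Icc.1 hi
  rw [Phi_step k n m r p x y i i2 ?_]
  · apply Finset.sum_le_sum
    intro l hl
    exact step_le (p i) (G i) (hp.1 i hi) (hp.2 i hi) (hG i hi) _ _ _ (d i hi l hl).1 (d i hi l hl).2
  · intro h l hl
    exact c (i+1) (Finset.mem_Icc.2 ⟨by omega, by omega⟩) l hl

/-- state probabilities of a policy accepting with conditional probabilities `ρ`; index shifted. -/
noncomputable def polX (k : ℕ) (ρ : ℕ → ℕ → ℝ) : ℕ → ℕ → ℝ
  | 0 => fun l => if l = k then 1 else 0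
  | (i+1) => fun l => polX k ρ i l - polX k ρ i l * ρ (i+1) l
      + (if l < k then polX k ρ i (l+1) * ρ (i+1) (l+1) else 0)

lemma DP_le {k n m : ℕ} (hk : 1 ≤ k) {r : ℕ → ℝ} (hr : IsValuation m r) {p G : ℕ → ℕ → ℝ}
    (hp : IsProb n m p) (hG : GRel n m p G) :
    ∃ x y, memP k n x y ∧
    DPval k n m r p ≤ ∑ j ∈ Icc 1 m, Dl m r j * coverSum k n G j x y := by
  classical
  set ρ : ℕ → ℕ → ℝ := fun i l => ∑ j ∈ Icc 1 m,
    if Vf n m r p (i+1) l - Vf n m r p (i+1) (l-1) < r j then p i j else 0 with hρ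
  have ρ0 : ∀ i ∈ Icc 1 n, ∀ l, 0 ≤ ρ i l ∧ ρ i l ≤ 1 := by
    intro i hi l
    constructor
    · apply Finset.sum_nonneg
      intro j hj
      have := hp.1 i hi j hj
      split_ifs <;> simp [this]
    · rw [← hp.2 i hi]
      apply Finset.sum_le_sum
      intro j hj
      have := hp.1 i hi j hj
      split_ifs <;> simp [this]
  have hx0 : ∀ i, i < n → ∀ l, 0 ≤ polX k ρ i l := by
    intro i
    induction i with
    | zero => intro _ l; simp only [polX]; split_ifs <;> norm_num
    | succ i ih =>
      intro h l
      have h1 := ih (by omega) l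
      have h2 := ih (by omega) (l+1)
      have hm : i + 1 ∈ Icc 1 n := Finset.mem_Icc.2 ⟨by omega, by omega⟩
      obtain ⟨r1, r2⟩ := ρ0 (i+1) hm l
      have r3 := (ρ0 (i+1) hm (l+1)).1
      simp only [polX]
      have : 0 ≤ polX k ρ i l * (1 - ρ (i+1) l) := mul_nonneg h1 (by linarith)
      have : 0 ≤ polX k ρ i (l+1) * ρ (i+1) (l+1) := mul_nonneg h2 r3
      split_ifs <;> nlinarith
  set x : ℕ → ℕ → ℝ := fun i l => polX k ρ (i-1) l with hx
  set y : ℕ → ℕ → ℝ := fun i l => x i l * ρ i l with hy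
  have hx1 : x 1 k = 1 := by simp [hx, polX]
  have hx2 : ∀ l, 1 ≤ l → l < k → x 1 l = 0 := by
    intro l _ h; simp [hx, polX, h.ne]
  have hflow : ∀ i, 1 ≤ i → ∀ l,
      x (i+1) l = x i l - y i l + (if l < k then y i (l+1) else 0) := by
    intro i hi l
    obtain ⟨t, rfl⟩ : ∃ t, i = t + 1 := ⟨i-1, by omega⟩
    simp [hx, hy, polX]
  have hxn : ∀ i ∈ Icc 1 n, ∀ l, 0 ≤ x i l := by
    intro i hi l
    obtain ⟨i1, i2⟩ := Finset.mem_Icc.1 hi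
    exact hx0 (i-1) (by omega) l
  refine ⟨x, y, ⟨hx1, hx2, ?_, ?_⟩, ?_⟩
  · intro i hi l hl
    obtain ⟨i1, i2⟩ := Finset.mem_Icc.1 hi
    obtain ⟨t, rfl⟩ : ∃ t, i = t + 1 := ⟨i-1, by omega⟩
    exact hflow t (by omega) l
  · intro i hi l hl
    have h1 := hxn i hi l
    obtain ⟨r1, r2⟩ := ρ0 i hi l
    exact ⟨mul_nonneg h1 r1, by simp only [hy]; nlinarith⟩
  · rw [← Phi_tel k n m hk r p x hx1 hx2, cov_swap]
    apply Finset.sum_le_sum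
    intro i hi
    obtain ⟨i1, i2⟩ := Finset.mem_Icc.1 hi
    rw [Phi_step k n m r p x y i i2 (fun _ l _ => hflow i i1 l)]
    apply Finset.sum_le_sum
    intro l hl
    exact step_ge hr (p i) (G i) (hp.1 i hi) (hG i hi) (x i l) _ (ρ i l) (hxn i hi l) rfl

lemma exAnte_eq {k n m : ℕ} {r : ℕ → ℝ} (hr : IsValuation m r) {p G : ℕ → ℕ → ℝ}
    (hp : IsProb n m p) (hG : GRel n m p G) :
    ExAnte k n m r p = ∑ j ∈ Icc 1 m, Dl m r j * QExAnte k n G j := by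
  have hQ : ∀ j, j ≤ m → ∑ i ∈ Icc 1 n, G i j = ∑ j' ∈ Icc 1 j, ∑ i ∈ Icc 1 n, p i j' := by
    intro j hj
    rw [Finset.sum_comm]
    exact Finset.sum_congr rfl (fun i hi => hG i hi j hj)
  apply IsGreatest.csSup_eq
  constructor
  · set F : ℕ → ℝ := QExAnte k n G with hF
    have F0 : F 0 = 0 := by
      simp only [hF, QExAnte]; rw [hQ 0 (by omega)]; simp
    refine ⟨fun j => F j - F (j-1), ?_, ?_, ?_⟩
    · intro j hj
      obtain ⟨j1, j2⟩ := Finset.mem_Icc.1 hj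
      have hP : 0 ≤ ∑ i ∈ Icc 1 n, p i j := Finset.sum_nonneg (fun i hi => hp.1 i hi j hj)
      have e : ∑ i ∈ Icc 1 n, G i j = ∑ i ∈ Icc 1 n, G i (j-1) + ∑ i ∈ Icc 1 n, p i j := by
        rw [hQ j j2, hQ (j-1) (by omega)]
        obtain ⟨t, rfl⟩ : ∃ t, j = t + 1 := ⟨j-1, by omega⟩
        rw [Finset.sum_Icc_succ_top (by omega)]; simp
      simp only [hF, QExAnte, e]
      generalize ∑ i ∈ Icc 1 n, G i (j-1) = A at *
      generalize ∑ i ∈ Icc 1 n, p i j = B at *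
      constructor
      · rw [sub_nonneg]; exact min_le_min (by linarith) le_rfl
      · rcases le_total A (k:ℝ) with h | h
        · rw [min_eq_left h]; have := min_le_left (A+B) (k:ℝ); linarith
        · rw [min_eq_right h]; have := min_le_right (A+B) (k:ℝ); linarith
    · rw [sum_incr F F0]; exact min_le_right _ _
    · rw [← abel m r (fun j => F j - F (j-1))]
      apply Finset.sum_congr rfl
      intro j _
      rw [sum_incr F F0]
  · rintro s ⟨a, h1, h2, rfl⟩
    rw [← abel]
    apply Finset.sum_le_sum
    intro j hj
    obtain ⟨j1, j2⟩ := Finset.mem_Icc.1 hj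
    have hsub : Icc 1 j ⊆ Icc 1 m := Finset.Icc_subset_Icc le_rfl j2
    apply mul_le_mul_of_nonneg_left _ (Dl_nonneg hr hj)
    apply le_min
    · rw [hQ j j2]
      exact Finset.sum_le_sum (fun i hi => (h1 i (hsub hi)).2)
    · exact (Finset.sum_le_sum_of_subset_of_nonneg hsub (fun i hi _ => (h1 i hi).1)).trans h2

lemma val_ind {m : ℕ} (r : ℕ → ℝ) {s : ℕ} (hs : s ∈ Icc 1 m) :
    r s = ∑ j ∈ Icc 1 m, Dl m r j * (if s ≤ j then 1 else 0) := by
  have h := abel m r (fun j => if j = s then 1 else 0)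
  have e : ∑ j ∈ Icc 1 m, r j * (if j = s then (1:ℝ) else 0) = r s := by
    simp only [mul_ite, mul_one, mul_zero]
    rw [Finset.sum_ite_eq' (Icc 1 m) s, if_pos hs]
  rw [← e, ← h]
  apply Finset.sum_congr rfl
  intro j _
  rw [Finset.sum_ite_eq' (Icc 1 j) s]
  have := (Finset.mem_Icc.1 hs).1
  simp [Finset.mem_Icc, this]

lemma exists_top (n k : ℕ) (t : Fin n → ℕ) (J : ℕ) :
    ∃ S : Finset (Fin n), S ⊆ univ.filter (fun i => t i ≤ J) ∧ S.card ≤ k ∧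
      ∀ j ≤ J, (S.filter (fun i => t i ≤ j)).card
        = min (univ.filter (fun i => t i ≤ j)).card k := by
  induction J with
  | zero =>
    obtain ⟨S, h1, h2⟩ := Finset.exists_subset_card_eq
      (min_le_left (univ.filter (fun i => t i ≤ 0)).card k)
    refine ⟨S, h1, by rw [h2]; exact min_le_right _ _, ?_⟩
    intro j hj
    obtain rfl : j = 0 := by omega
    rw [Finset.filter_true_of_mem, h2]
    intro i hi
    exact (Finset.mem_filter.1 (h1 hi)).2
  | succ J ih =>
    obtain ⟨S, h1, h2, h3⟩ := ih
    have hmono : univ.filter (fun i => t i ≤ J) ⊆ univ.filter (fun i => t i ≤ J+1) := by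
      intro i hi
      simp only [Finset.mem_filter, Finset.mem_univ, true_and] at hi ⊢
      omega
    have hSJ : S.card = min (univ.filter (fun i => t i ≤ J)).card k := by
      rw [← h3 J le_rfl, Finset.filter_true_of_mem]
      intro i hi
      exact (Finset.mem_filter.1 (h1 hi)).2
    have hc := Finset.card_le_card hmono
    obtain ⟨T, hT1, hT2, hT3⟩ := Finset.exists_subsuperset_card_eq (h1.trans hmono)
      (n := min (univ.filter (fun i => t i ≤ J+1)).card k) (by rw [hSJ]; omega)
      (min_le_left _ _)
    refine ⟨T, hT2, by rw [hT3]; exact min_le_right _ _, ?_⟩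
    intro j hj
    rcases Nat.lt_or_ge j (J+1) with h | h
    · rw [← h3 j (by omega)]
      by_cases hk : k ≤ (univ.filter (fun i => t i ≤ J)).card
      · have : S = T := Finset.eq_of_subset_of_card_le hT1 (by rw [hT3, hSJ]; omega)
        rw [this]
      · have hS : S = univ.filter (fun i => t i ≤ J) :=
          Finset.eq_of_subset_of_card_le h1 (by rw [hSJ]; omega)
        congr 1
        apply Finset.Subset.antisymm
        · intro i hi
          rw [Finset.mem_filter] at hi ⊢
          refine ⟨?_, hi.2⟩
          rw [hS]
          simp only [Finset.mem_filter, Finset.mem_univ, true_and]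
          omega
        · exact Finset.filter_subset_filter _ hT1
    · obtain rfl : j = J + 1 := by omega
      rw [Finset.filter_true_of_mem, hT3]
      intro i hi
      exact (Finset.mem_filter.1 (hT2 hi)).2

lemma sum_val {n m : ℕ} (r : ℕ → ℝ) (t : Fin n → ℕ) (ht : ∀ i, t i ∈ Icc 1 m)
    (S : Finset (Fin n)) :
    ∑ i ∈ S, r (t i) = ∑ j ∈ Icc 1 m, Dl m r j * ((S.filter (fun i => t i ≤ j)).card : ℝ) := by
  rw [Finset.sum_congr rfl (fun i _ => val_ind r (ht i)), Finset.sum_comm]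
  apply Finset.sum_congr rfl
  intro j _
  rw [← Finset.mul_sum]
  simp

lemma prophVal_eq {k n m : ℕ} {r : ℕ → ℝ} (hr : IsValuation m r) (t : Fin n → ℕ)
    (ht : ∀ i, t i ∈ Icc 1 m) :
    prophVal n k (fun i => r (t i)) = ∑ j ∈ Icc 1 m, Dl m r j *
      min ((univ.filter (fun i => t i ≤ j)).card : ℝ) (k : ℝ) := by
  apply IsGreatest.csSup_eq
  constructor
  · obtain ⟨S, -, h2, h3⟩ := exists_top n k t m
    refine ⟨S, h2, ?_⟩
    rw [sum_val r t ht]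
    apply Finset.sum_congr rfl
    intro j hj
    rw [h3 j (Finset.mem_Icc.1 hj).2, Nat.cast_min]
  · rintro s ⟨S, h2, rfl⟩
    rw [sum_val r t ht]
    apply Finset.sum_le_sum
    intro j hj
    apply mul_le_mul_of_nonneg_left _ (Dl_nonneg hr hj)
    rw [← Nat.cast_min, Nat.cast_le]
    apply le_min
    · exact Finset.card_le_card (Finset.filter_subset_filter _ (Finset.subset_univ _))
    · exact (Finset.card_filter_le _ _).trans h2

/-- `eMinBer` as a sum over subsets of `Fin n`. -/
lemma eMinBer_fin (q : ℕ → ℝ) (n k : ℕ) :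
    eMinBer q n k = ∑ S : Finset (Fin n),
      (∏ i : Fin n, if i ∈ S then q (i.1+1) else 1 - q (i.1+1)) * min (S.card : ℝ) (k : ℝ) := by
  classical
  let e : Fin n ↪ ℕ := ⟨fun i => i.1 + 1, fun a b h => Fin.ext (by simpa using h)⟩
  have hI : Icc 1 n = univ.map e := by
    ext a
    simp only [Finset.mem_Icc, Finset.mem_map, Finset.mem_univ, true_and]
    constructor
    · rintro ⟨h1, h2⟩
      refine ⟨⟨a-1, by omega⟩, ?_⟩
      change a - 1 + 1 = a
      omega
    · rintro ⟨b, rfl⟩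
      have := b.2
      change 1 ≤ b.1 + 1 ∧ b.1 + 1 ≤ n
      omega
  unfold eMinBer
  symm
  apply Finset.sum_bij (fun S _ => S.map e)
  · intro S _
    rw [Finset.mem_powerset, hI]
    exact Finset.map_subset_map.2 (Finset.subset_univ _)
  · intro S _ T _ h
    exact Finset.map_injective e h
  · intro T hT
    rw [Finset.mem_powerset, hI] at hT
    obtain ⟨S, _, rfl⟩ := Finset.subset_map_iff.1 hT
    exact ⟨S, Finset.mem_univ _, rfl⟩
  · intro S _
    rw [hI, ← Finset.map_sdiff, Finset.prod_map, Finset.prod_map, Finset.card_map,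
      Finset.prod_ite, Finset.filter_mem_eq_inter, Finset.univ_inter]
    congr 3
    ext i; simp

lemma ber_expect {n m : ℕ} {p G : ℕ → ℕ → ℝ} (hp : IsProb n m p) (hG : GRel n m p G)
    (k j : ℕ) (hj : j ≤ m) :
    ∑ t ∈ Fintype.piFinset (fun _ : Fin n => Icc 1 m),
      (∏ i : Fin n, p (i.1+1) (t i)) *
        min ((univ.filter (fun i => t i ≤ j)).card : ℝ) (k : ℝ) = QProph k n G j := by
  classical
  have hex : ∀ t : Fin n → ℕ, min ((univ.filter (fun i => t i ≤ j)).card : ℝ) (k : ℝ)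
      = ∑ S : Finset (Fin n), (∏ i : Fin n, if (i ∈ S ↔ t i ≤ j) then (1:ℝ) else 0) *
        min (S.card : ℝ) (k : ℝ) := by
    intro t
    rw [Finset.sum_eq_single (univ.filter (fun i => t i ≤ j))]
    · simp
    · intro S _ hS
      have : ∃ i, ¬ (i ∈ S ↔ t i ≤ j) := by
        by_contra! h
        apply hS
        ext i
        simp [h i]
      obtain ⟨i, hi⟩ := this
      rw [Finset.prod_eq_zero (Finset.mem_univ i) (if_neg hi), zero_mul]
    · intro h; exact absurd (Finset.mem_univ _) h
  unfold QProph
  rw [eMinBer_fin]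
  simp only [hex, Finset.mul_sum]
  rw [Finset.sum_comm]
  apply Finset.sum_congr rfl
  intro S _
  have key : ∑ t ∈ Fintype.piFinset (fun _ : Fin n => Icc 1 m),
      ∏ i : Fin n, (p (i.1+1) (t i) * if (i ∈ S ↔ t i ≤ j) then (1:ℝ) else 0)
      = ∏ i : Fin n, if i ∈ S then G (i.1+1) j else 1 - G (i.1+1) j := by
    rw [← Finset.prod_univ_sum (fun _ : Fin n => Icc 1 m)
      (fun i s => p (i.1+1) s * if (i ∈ S ↔ s ≤ j) then (1:ℝ) else 0)]
    apply Finset.prod_congr rfl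
    intro i _
    have hi : i.1 + 1 ∈ Icc 1 n := Finset.mem_Icc.2 ⟨by omega, by have := i.2; omega⟩
    have e1 : ∑ s ∈ Icc 1 m, (if s ≤ j then p (i.1+1) s else 0) = G (i.1+1) j := by
      rw [hG _ hi j hj, ← Finset.sum_filter]
      congr 1
      ext s; simp; omega
    split_ifs with h
    · rw [← e1]
      apply Finset.sum_congr rfl
      intro s _
      simp [h]
    · have e2 : 1 - G (i.1+1) j = ∑ s ∈ Icc 1 m, (p (i.1+1) s - if s ≤ j then p (i.1+1) s else 0) := by
        rw [Finset.sum_sub_distrib, e1, hp.2 _ hi]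
      rw [e2]
      apply Finset.sum_congr rfl
      intro s _
      by_cases hs : s ≤ j <;> simp [h, hs]
  rw [← key, Finset.sum_mul]
  apply Finset.sum_congr rfl
  intro t _
  rw [Finset.prod_mul_distrib]
  ring

lemma proph_eq {k n m : ℕ} {r : ℕ → ℝ} (hr : IsValuation m r) {p G : ℕ → ℕ → ℝ}
    (hp : IsProb n m p) (hG : GRel n m p G) :
    Proph k n m r p = ∑ j ∈ Icc 1 m, Dl m r j * QProph k n G j := by
  have h : Proph k n m r p = ∑ t ∈ Fintype.piFinset (fun _ : Fin n => Icc 1 m),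
    ∑ j ∈ Icc 1 m, Dl m r j * ((∏ i : Fin n, p (i.1+1) (t i)) *
        min ((univ.filter (fun i => t i ≤ j)).card : ℝ) (k : ℝ)) := by
    unfold Proph
    apply Finset.sum_congr rfl
    intro t ht
    rw [prophVal_eq hr t (fun i => Fintype.mem_piFinset.1 ht i), Finset.mul_sum]
    apply Finset.sum_congr rfl
    intros; ring
  rw [h, Finset.sum_comm]
  apply Finset.sum_congr rfl
  intro j hj
  rw [← Finset.mul_sum, ber_expect hp hG k j (Finset.mem_Icc.1 hj).2]

lemma eMinBer_nonneg (q : ℕ → ℝ) (n k : ℕ) (h : ∀ i ∈ Icc 1 n, 0 ≤ q i ∧ q i ≤ 1) :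
    0 ≤ eMinBer q n k := by
  apply Finset.sum_nonneg
  intro S hS
  have hS := Finset.mem_powerset.1 hS
  apply mul_nonneg (mul_nonneg _ _) (by positivity)
  · exact Finset.prod_nonneg (fun i hi => (h i (hS hi)).1)
  · exact Finset.prod_nonneg (fun i hi => sub_nonneg.2 (h i (Finset.mem_sdiff.1 hi).1).2)

lemma eMinBer_one (q : ℕ → ℝ) (n k : ℕ) (h : ∀ i ∈ Icc 1 n, q i = 1) :
    eMinBer q n k = min (n:ℝ) k := by
  unfold eMinBer
  rw [Finset.sum_eq_single (Icc 1 n)]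
  · rw [Finset.prod_congr rfl h]; simp
  · intro S hS hne
    have hS := Finset.mem_powerset.1 hS
    obtain ⟨i, hi, hi2⟩ := Finset.exists_of_ssubset (hS.ssubset_of_ne hne)
    rw [Finset.prod_eq_zero (Finset.mem_sdiff.2 ⟨hi, hi2⟩) (by rw [h i hi, sub_self])]
    simp
  · intro h; exact absurd (Finset.mem_powerset_self _) h

lemma memP_combo {k n : ℕ} {x y x' y' : ℕ → ℕ → ℝ} {a b : ℝ} (ha : 0 ≤ a) (hb : 0 ≤ b)
    (hab : a + b = 1) (h : memP k n x y) (h' : memP k n x' y') :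
    memP k n (fun i l => a * x i l + b * x' i l) (fun i l => a * y i l + b * y' i l) := by
  obtain ⟨h1, h2, h3, h4⟩ := h
  obtain ⟨g1, g2, g3, g4⟩ := h'
  refine ⟨?_, ?_, ?_, ?_⟩
  · simp [h1, g1, hab]
  · intro l hl hlk; simp [h2 l hl hlk, g2 l hl hlk]
  · intro i hi l hl
    simp only [h3 i hi l hl, g3 i hi l hl]
    split_ifs <;> ring
  · intro i hi l hl
    obtain ⟨u1, u2⟩ := h4 i hi l hl
    obtain ⟨v1, v2⟩ := g4 i hi l hl
    constructor
    · positivity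
    · simp only
      gcongr

lemma cov_combo {k n : ℕ} (G : ℕ → ℕ → ℝ) (j : ℕ) {x y x' y' : ℕ → ℕ → ℝ} {a b : ℝ}
    (ha : 0 ≤ a) (hb : 0 ≤ b) :
    a * coverSum k n G j x y + b * coverSum k n G j x' y' ≤
    coverSum k n G j (fun i l => a * x i l + b * x' i l) (fun i l => a * y i l + b * y' i l) := by
  unfold coverSum
  rw [Finset.mul_sum, Finset.mul_sum, ← Finset.sum_add_distrib]
  apply Finset.sum_le_sum
  intro i _
  rw [Finset.mul_sum, Finset.mul_sum, ← Finset.sum_add_distrib]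
  apply Finset.sum_le_sum
  intro l _
  have h1 := min_le_left (y i l) (G i j * x i l)
  have h2 := min_le_right (y i l) (G i j * x i l)
  have h3 := min_le_left (y' i l) (G i j * x' i l)
  have h4 := min_le_right (y' i l) (G i j * x' i l)
  apply le_min
  · nlinarith
  · nlinarith

lemma cov_nonneg {k n : ℕ} {G : ℕ → ℕ → ℝ} {j : ℕ} {x y : ℕ → ℕ → ℝ} (h : memP k n x y)
    (hG : ∀ i ∈ Icc 1 n, 0 ≤ G i j) : 0 ≤ coverSum k n G j x y := by
  apply Finset.sum_nonneg
  intro i hi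
  apply Finset.sum_nonneg
  intro l hl
  obtain ⟨u1, u2⟩ := h.2.2.2 i hi l hl
  exact le_min u1 (mul_nonneg (hG i hi) (u1.trans u2))

lemma memP_triv (k n : ℕ) : memP k n (fun _ l => if l = k then 1 else 0) (fun _ _ => 0) := by
  refine ⟨by simp, ?_, ?_, ?_⟩
  · intro l _ h; simp [h.ne]
  · intro i _ l _; simp
  · intro i _ l _; simp only; split_ifs <;> simp

/-- Separation step (strong duality). -/
lemma separation {k n m : ℕ} {G : ℕ → ℕ → ℝ} {Q : ℕ → ℝ} (hQ : ∀ j ∈ Icc 1 m, 0 ≤ Q j)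
    (hG : ∀ i ∈ Icc 1 n, ∀ j ∈ Icc 1 m, 0 ≤ G i j) {θ : ℝ}
    (hθ : ¬ ∃ x y, memP k n x y ∧ ∀ j ∈ Icc 1 m, θ * Q j ≤ coverSum k n G j x y) :
    ∃ w : ℕ → ℝ, (∀ j ∈ Icc 1 m, 0 ≤ w j) ∧ 0 < ∑ j ∈ Icc 1 m, w j * Q j ∧
      ∀ x y, memP k n x y → ∑ j ∈ Icc 1 m, w j * coverSum k n G j x y
        ≤ θ * ∑ j ∈ Icc 1 m, w j * Q j := by
  classical
  set J : Finset ℕ := (Icc 1 m).filter (fun j => 0 < Q j) with hJ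
  have hJm : ∀ j : J, (j:ℕ) ∈ Icc 1 m ∧ 0 < Q j := fun j => Finset.mem_filter.1 j.2
  set A : Set (J → ℝ) := {z | ∃ x y, memP k n x y ∧ ∀ j : J, z j < coverSum k n G j x y} with hA
  have hopen : IsOpen A := by
    have : A = ⋃ (x : ℕ → ℕ → ℝ) (y : ℕ → ℕ → ℝ) (_ : memP k n x y),
        ⋂ j : J, {z : J → ℝ | z j < coverSum k n G j x y} := by
      ext z; simp [hA]
    rw [this]
    refine isOpen_iUnion fun x => isOpen_iUnion fun y => isOpen_iUnion fun _ =>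
      isOpen_iInter_of_finite fun j => isOpen_lt (continuous_apply j) continuous_const
  have hconv : Convex ℝ A := by
    rintro z ⟨x, y, h, hz⟩ z' ⟨x', y', h', hz'⟩ a b ha hb hab
    refine ⟨_, _, memP_combo ha hb hab h h', fun j => ?_⟩
    refine lt_of_lt_of_le ?_ (cov_combo G j ha hb)
    simp only [Pi.add_apply, Pi.smul_apply, smul_eq_mul]
    have u1 := hz j
    have u2 := hz' j
    rcases ha.eq_or_lt with rfl | ha
    · have : b = 1 := by linarith
      subst this; linarith
    · have := mul_lt_mul_of_pos_left u1 ha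
      have := mul_le_mul_of_nonneg_left u2.le hb
      linarith
  have hnot : (fun j : J => θ * Q j) ∉ A := by
    rintro ⟨x, y, h, hz⟩
    apply hθ
    refine ⟨x, y, h, fun j hj => ?_⟩
    rcases (hQ j hj).eq_or_lt with h0 | h0
    · rw [← h0, mul_zero]; exact cov_nonneg h (fun i hi => hG i hi j hj)
    · exact (hz ⟨j, Finset.mem_filter.2 ⟨hj, h0⟩⟩).le
  obtain ⟨f, hf⟩ := geometric_hahn_banach_open_point hconv hopen hnot
  set v : J → ℝ := fun j => f (Pi.single j 1) with hv
  have hfv : ∀ z : J → ℝ, f z = ∑ j, z j * v j := by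
    intro z
    conv_lhs => rw [pi_eq_sum_univ' z, map_sum]
    apply Finset.sum_congr rfl
    intro j _
    rw [map_smul, smul_eq_mul, hv]
  -- nonnegativity
  set z0 : J → ℝ := fun j => coverSum k n G j
    (fun _ l => if l = k then 1 else 0) (fun _ _ => 0) - 1 with hz0
  have hz0A : z0 ∈ A := ⟨_, _, memP_triv k n, fun j => by simp only [hz0]; linarith⟩
  have hvn : ∀ j, 0 ≤ v j := by
    intro j
    by_contra! hneg
    set t : ℝ := (f (fun j : J => θ * Q j) - f z0) / (- v j) with ht
    have ht0 : 0 < t := div_pos (by linarith [hf z0 hz0A]) (by linarith)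
    have hmem : z0 - t • (Pi.single j 1 : J → ℝ) ∈ A := by
      refine ⟨_, _, memP_triv k n, fun i => ?_⟩
      have : 0 ≤ t * (Pi.single j (1:ℝ) : J → ℝ) i := by
        apply mul_nonneg ht0.le
        rw [Pi.single_apply]; split_ifs <;> norm_num
      simp only [Pi.sub_apply, Pi.smul_apply, smul_eq_mul, hz0]
      linarith
    have h1 := hf _ hmem
    rw [map_sub, map_smul, smul_eq_mul] at h1
    have h2 : t * v j = -(f (fun j : J => θ * Q j) - f z0) := by
      rw [ht, div_neg, neg_mul, div_mul_cancel₀ _ hneg.ne]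
    have h3 : f (Pi.single j 1) = v j := rfl
    rw [h3, h2] at h1
    linarith
  have hvpos : ∃ j, 0 < v j := by
    by_contra! h
    have hz : ∀ j, v j = 0 := fun j => le_antisymm (h j) (hvn j)
    have := hf z0 hz0A
    rw [hfv, hfv] at this
    simp [hz] at this
  obtain ⟨j0, hj0⟩ := hvpos
  set w : ℕ → ℝ := fun j => if h : j ∈ J then v ⟨j, h⟩ else 0 with hw
  have hwsum : ∀ c : ℕ → ℝ, ∑ j ∈ Icc 1 m, w j * c j = ∑ j : J, v j * c j := by
    intro c
    have e1 : ∑ j ∈ Icc 1 m, w j * c j = ∑ j ∈ J, w j * c j := by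
      symm
      apply Finset.sum_subset (Finset.filter_subset _ _)
      intro j _ hj
      have hj' : j ∉ J := hj
      simp only [hw]
      rw [dif_neg hj', zero_mul]
    rw [e1, ← Finset.sum_coe_sort]
    apply Finset.sum_congr rfl
    intro j _
    simp [hw]
  have hpos : ∀ c : ℕ → ℝ, (∀ j : J, 0 < c j) → 0 < ∑ j : J, v j * c j := by
    intro c hc
    apply Finset.sum_pos' (fun j _ => mul_nonneg (hvn j) (hc j).le)
    exact ⟨j0, Finset.mem_univ _, mul_pos hj0 (hc j0)⟩
  refine ⟨w, ?_, ?_, ?_⟩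
  · intro j _
    simp only [hw]
    split_ifs with h
    · exact hvn _
    · exact le_rfl
  · rw [hwsum]; exact hpos Q (fun j => (hJm j).2)
  · intro x y hxy
    rw [hwsum, hwsum]
    by_contra! hlt
    set s : ℝ := ∑ j : J, v j with hs
    have hspos : 0 < s := by
      have := hpos (fun _ => 1) (fun _ => one_pos)
      simp only [mul_one] at this
      exact this
    set D : ℝ := ∑ j : J, v j * coverSum k n G j x y - θ * ∑ j : J, v j * Q j with hD
    have hDpos : 0 < D := by linarith
    have hmem : (fun j : J => coverSum k n G j x y - D / s) ∈ A :=
      ⟨x, y, hxy, fun j => by have := div_pos hDpos hspos; simp only; linarith⟩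
    have h1 := hf _ hmem
    rw [hfv, hfv] at h1
    have e1 : ∑ j : J, (coverSum k n G j x y - D / s) * v j
        = ∑ j : J, v j * coverSum k n G j x y - D / s * s := by
      rw [hs, Finset.mul_sum, ← Finset.sum_sub_distrib]
      apply Finset.sum_congr rfl
      intros; ring
    have e2 : ∑ j : J, θ * Q j * v j = θ * ∑ j : J, v j * Q j := by
      rw [Finset.mul_sum]
      apply Finset.sum_congr rfl
      intros; ring
    rw [e1, e2, div_mul_cancel₀ _ hspos.ne'] at h1
    linarith

lemma typeDist_mono {n m : ℕ} {G : ℕ → ℕ → ℝ} (hG : IsTypeDist n m G) {i : ℕ} (hi : i ∈ Icc 1 n)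
    {j : ℕ} (hj : j ≤ m) : 0 ≤ G i j ∧ G i j ≤ 1 := by
  obtain ⟨h0, h1, h2⟩ := hG i hi
  constructor
  · induction j with
    | zero => rw [h0]
    | succ j ih =>
      have := h2 (j+1) (Finset.mem_Icc.2 ⟨by omega, hj⟩)
      simp only [Nat.add_sub_cancel] at this
      linarith [ih (by omega)]
  · have : ∀ d, d ≤ m → G i (m - d) ≤ 1 := by
      intro d
      induction d with
      | zero => intro _; simp [h1]
      | succ d ih =>
        intro hd
        have := h2 (m - d) (Finset.mem_Icc.2 ⟨by omega, by omega⟩)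
        rw [show m - d - 1 = m - (d+1) by omega] at this
        linarith [ih (by omega)]
    have := this (m - j) (by omega)
    rwa [show m - (m - j) = j by omega] at this

lemma main_aux (k n : ℕ) (hk : 1 ≤ k)
    (B : ℕ → (ℕ → ℝ) → (ℕ → ℕ → ℝ) → ℝ) (Q : (ℕ → ℕ → ℝ) → ℕ → ℝ)
    (hB : ∀ m r p G, IsValuation m r → IsProb n m p → GRel n m p G →
      B m r p = ∑ j ∈ Icc 1 m, Dl m r j * Q G j)
    (hQ0 : ∀ m G, IsTypeDist n m G → ∀ j ∈ Icc 1 m, 0 ≤ Q G j)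
    (hQm : ∀ m G, IsTypeDist n m G → 0 < Q G m) :
    sInf {v : ℝ | ∃ m, 1 ≤ m ∧ ∃ (r : ℕ → ℝ) (p : ℕ → ℕ → ℝ),
        IsValuation m r ∧ IsProb n m p ∧ 0 < B m r p ∧
        v = DPval k n m r p / B m r p}
      = sInf {v : ℝ | ∃ m, 1 ≤ m ∧ ∃ G, IsTypeDist n m G ∧
          v = innerLP_DP k n m G (Q G)} := by
  set S1 := {v : ℝ | ∃ m, 1 ≤ m ∧ ∃ (r : ℕ → ℝ) (p : ℕ → ℕ → ℝ),
        IsValuation m r ∧ IsProb n m p ∧ 0 < B m r p ∧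
        v = DPval k n m r p / B m r p} with hS1
  set S2 := {v : ℝ | ∃ m, 1 ≤ m ∧ ∃ G, IsTypeDist n m G ∧
          v = innerLP_DP k n m G (Q G)} with hS2
  have hbdd : ∀ m G, 1 ≤ m → IsTypeDist n m G →
      BddAbove {θ : ℝ | ∃ x y, memP k n x y ∧
        ∀ j ∈ Icc 1 m, θ * Q G j ≤ coverSum k n G j x y} := by
    intro m G hm hG
    -- every coverage is at most `n`-fold telescoped state mass; use `DP_ge` with `r = 1`
    set p : ℕ → ℕ → ℝ := fun i j => G i j - G i (j-1) with hp
    have hrel : GRel n m p G := by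
      intro i hi j _
      rw [hp]; simp only
      rw [sum_incr (G i) (hG i hi).1]
    have hprob : IsProb n m p := by
      refine ⟨fun i hi j hj => sub_nonneg.2 ((hG i hi).2.2 j hj), fun i hi => ?_⟩
      rw [← hrel i hi m le_rfl, (hG i hi).2.1]
    set r : ℕ → ℝ := fun _ => 1 with hr
    have hDl : ∀ j ∈ Icc 1 m, Dl m r j = if j = m then 1 else 0 := by
      intro j hj
      obtain ⟨j1, j2⟩ := Finset.mem_Icc.1 hj
      simp only [Dl, hr, if_pos j2]
      by_cases h : j = m
      · simp [h]
      · rw [if_pos (by omega), if_neg h]; norm_num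
    refine ⟨DPval k n m r p / Q G m, ?_⟩
    rintro θ ⟨x, y, hxy, hθ⟩
    rw [le_div_iff₀ (hQm m G hG)]
    have hmm : m ∈ Icc 1 m := Finset.mem_Icc.2 ⟨hm, le_rfl⟩
    have h1 := DP_ge (r := r) hk hprob hrel hxy
    rw [Finset.sum_congr rfl (fun j hj => by rw [hDl j hj])] at h1
    simp only [ite_mul, one_mul, zero_mul] at h1
    rw [Finset.sum_ite_eq' (Icc 1 m) m, if_pos hmm] at h1
    exact (hθ m hmm).trans h1
  have h0mem : ∀ m G, IsTypeDist n m G → (0:ℝ) ∈ {θ : ℝ | ∃ x y, memP k n x y ∧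
        ∀ j ∈ Icc 1 m, θ * Q G j ≤ coverSum k n G j x y} := by
    intro m G hG
    refine ⟨_, _, memP_triv k n, fun j hj => ?_⟩
    rw [zero_mul]
    exact cov_nonneg (memP_triv k n)
      (fun i hi => (typeDist_mono hG hi (Finset.mem_Icc.1 hj).2).1)
  -- weak duality
  have hweak : ∀ a ∈ S1, ∃ b ∈ S2, b ≤ a := by
    rintro a ⟨m, hm, r, p, hr, hp, hpos, rfl⟩
    set G : ℕ → ℕ → ℝ := fun i j => ∑ j' ∈ Icc 1 j, p i j' with hGdef
    have hrel : GRel n m p G := fun i _ j _ => rfl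
    have hG : IsTypeDist n m G := by
      intro i hi
      refine ⟨by simp [hGdef], hp.2 i hi, fun j hj => ?_⟩
      obtain ⟨j1, j2⟩ := Finset.mem_Icc.1 hj
      apply Finset.sum_le_sum_of_subset_of_nonneg
      · exact Finset.Icc_subset_Icc le_rfl (by omega)
      · intro s hs _
        exact hp.1 i hi s (Finset.Icc_subset_Icc le_rfl j2 hs)
    refine ⟨_, ⟨m, hm, G, hG, rfl⟩, ?_⟩
    apply csSup_le ⟨0, h0mem m G hG⟩
    rintro θ ⟨x, y, hxy, hθ⟩
    rw [le_div_iff₀ hpos, hB m r p G hr hp hrel]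
    refine le_trans ?_ (DP_ge (r := r) hk hp hrel hxy)
    rw [Finset.mul_sum]
    apply Finset.sum_le_sum
    intro j hj
    have := mul_le_mul_of_nonneg_left (hθ j hj) (Dl_nonneg hr hj)
    linarith
  -- strong duality
  have hstrong : ∀ b ∈ S2, ∀ θ, b < θ → ∃ a ∈ S1, a ≤ θ := by
    rintro b ⟨m, hm, G, hG, rfl⟩ θ hθ
    have hnot : ¬ ∃ x y, memP k n x y ∧ ∀ j ∈ Icc 1 m, θ * Q G j ≤ coverSum k n G j x y := by
      intro h
      exact absurd (le_csSup (hbdd m G hm hG) h) (not_le.2 hθ)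
    obtain ⟨w, hw0, hwpos, hw⟩ := separation (hQ0 m G hG)
      (fun i hi j hj => (typeDist_mono hG hi (Finset.mem_Icc.1 hj).2).1) hnot
    set p : ℕ → ℕ → ℝ := fun i j => G i j - G i (j-1) with hp
    have hrel : GRel n m p G := by
      intro i hi j _
      rw [hp]; simp only
      rw [sum_incr (G i) (hG i hi).1]
    have hprob : IsProb n m p := by
      refine ⟨fun i hi j hj => sub_nonneg.2 ((hG i hi).2.2 j hj), fun i hi => ?_⟩
      rw [← hrel i hi m le_rfl, (hG i hi).2.1]
    set r : ℕ → ℝ := fun j => ∑ j' ∈ Icc j m, w j' with hr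
    have hrs : ∀ j, j ≤ m → r j = w j + r (j+1) := by
      intro j hj
      simp only [hr]
      rw [← Finset.add_sum_Ioc_eq_sum_Icc hj]
      have hset : Ioc j m = Icc (j+1) m := by
        ext a
        simp only [Finset.mem_Ioc, Finset.mem_Icc]
        omega
      rw [hset]
    have hval : IsValuation m r := by
      constructor
      · intro j h1 h2
        have := hw0 j (Finset.mem_Icc.2 ⟨h1, h2.le⟩)
        linarith [hrs j h2.le]
      · simp only [hr, Finset.Icc_self, Finset.sum_singleton]
        exact hw0 m (Finset.mem_Icc.2 ⟨hm, le_rfl⟩)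
    have hDl : ∀ j ∈ Icc 1 m, Dl m r j = w j := by
      intro j hj
      obtain ⟨j1, j2⟩ := Finset.mem_Icc.1 hj
      simp only [Dl, if_pos j2]
      have e := hrs j j2
      split_ifs with h
      · linarith
      · have : r (j+1) = 0 := by
          simp only [hr]; rw [Finset.Icc_eq_empty (by omega)]; simp
        linarith
    have hBv : B m r p = ∑ j ∈ Icc 1 m, w j * Q G j := by
      rw [hB m r p G hval hprob hrel]
      exact Finset.sum_congr rfl (fun j hj => by rw [hDl j hj])
    obtain ⟨x, y, hxy, hDP⟩ := DP_le (k := k) hk hval hprob hrel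
    rw [Finset.sum_congr rfl (fun j hj => by rw [hDl j hj])] at hDP
    refine ⟨_, ⟨m, hm, r, p, hval, hprob, by rw [hBv]; exact hwpos, rfl⟩, ?_⟩
    rw [hBv, div_le_iff₀ hwpos]
    exact hDP.trans (hw x y hxy)
  have hb2 : ∀ b ∈ S2, 0 ≤ b := by
    rintro b ⟨m, hm, G, hG, rfl⟩
    exact le_csSup (hbdd m G hm hG) (h0mem m G hG)
  have hb1 : ∀ a ∈ S1, 0 ≤ a := by
    intro a ha
    obtain ⟨b, hb, hba⟩ := hweak a ha
    exact (hb2 b hb).trans hba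
  have hne2 : S2.Nonempty := by
    refine ⟨_, 1, le_rfl, fun _ j => if j = 0 then 0 else 1, ?_, rfl⟩
    intro i _
    refine ⟨by simp, by simp, fun j hj => ?_⟩
    obtain ⟨j1, j2⟩ := Finset.mem_Icc.1 hj
    obtain rfl : j = 1 := by omega
    simp
  have hne1 : S1.Nonempty := by
    obtain ⟨b, hb⟩ := hne2
    obtain ⟨a, ha, _⟩ := hstrong b hb (b+1) (by linarith)
    exact ⟨a, ha⟩
  apply le_antisymm
  · apply le_csInf hne2
    intro b hb
    apply le_of_forall_gt_imp_ge_of_dense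
    intro θ hθ
    obtain ⟨a, ha, hle⟩ := hstrong b hb θ hθ
    exact (csInf_le ⟨0, hb1⟩ ha).trans hle
  · apply le_csInf hne1
    intro a ha
    obtain ⟨b, hb, hle⟩ := hweak a ha
    exact (csInf_le ⟨0, hb2⟩ hb).trans hle
/-- Reformulation of tight guarantees for DP:
`inf_I DP(I)/Proph(I) = inf_G innerLP^{DP/Proph}_{k,n}(G)` and
`inf_I DP(I)/ExAnte(I) = inf_G innerLP^{DP/ExAnte}_{k,n}(G)`. -/
theorem stmt3 (k n : ℕ) (hk : 1 ≤ k) (hkn : k < n) :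
    (sInf {v : ℝ | ∃ m, 1 ≤ m ∧ ∃ (r : ℕ → ℝ) (p : ℕ → ℕ → ℝ),
        IsValuation m r ∧ IsProb n m p ∧ 0 < Proph k n m r p ∧
        v = DPval k n m r p / Proph k n m r p}
      = sInf {v : ℝ | ∃ m, 1 ≤ m ∧ ∃ G, IsTypeDist n m G ∧
          v = innerLP_DP k n m G (QProph k n G)}) ∧
    (sInf {v : ℝ | ∃ m, 1 ≤ m ∧ ∃ (r : ℕ → ℝ) (p : ℕ → ℕ → ℝ),
        IsValuation m r ∧ IsProb n m p ∧ 0 < ExAnte k n m r p ∧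
        v = DPval k n m r p / ExAnte k n m r p}
      = sInf {v : ℝ | ∃ m, 1 ≤ m ∧ ∃ G, IsTypeDist n m G ∧
          v = innerLP_DP k n m G (QExAnte k n G)}) := by
  have hn : 1 ≤ n := by omega
  have hmin : (0:ℝ) < min (n:ℝ) (k:ℝ) :=
    lt_min (by exact_mod_cast hn) (by exact_mod_cast hk)
  constructor
  · apply main_aux k n hk (fun m r p => Proph k n m r p) (QProph k n)
    · intro m r p G hr hp hG
      exact proph_eq hr hp hG
    · intro m G hG j hj
      exact eMinBer_nonneg _ _ _ (fun i hi => typeDist_mono hG hi (Finset.mem_Icc.1 hj).2)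
    · intro m G hG
      unfold QProph
      rw [eMinBer_one _ _ _ (fun i hi => (hG i hi).2.1)]
      exact hmin
  · apply main_aux k n hk (fun m r p => ExAnte k n m r p) (QExAnte k n)
    · intro m r p G hr hp hG
      exact exAnte_eq hr hp hG
    · intro m G hG j hj
      exact le_min (Finset.sum_nonneg (fun i hi =>
        (typeDist_mono hG hi (Finset.mem_Icc.1 hj).2).1)) (by positivity)
    · intro m G hG
      unfold QExAnte
      rw [Finset.sum_congr rfl (fun i hi => (hG i hi).2.1)]
      simpa using hmin
end

section
/- There exist constants c, C > 0 and an integer K such that for every integer k ≥ K and every real λ > 0 satisfying P(N_λ ≤ k-1) = E[min{N_λ, k}]/k, where N_λ is a Poisson random variable with mean λ, it holds that 1 - C·√(log k / k) ≤ P(N_λ ≤ k-1) ≤ 1 - c·√(log k / k). -/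
/-- `P(N_λ ≤ k-1) = P(N_λ < k)` for a Poisson random variable `N_λ` with mean `λ`. -/
noncomputable def poisCDFlt (lam : ℝ) (k : ℕ) : ℝ :=
  ∑ d ∈ Finset.range k, Real.exp (-lam) * lam ^ d / (Nat.factorial d)

/-- `E[min{N_λ, k}]` for a Poisson random variable `N_λ` with mean `λ`. -/
noncomputable def poisEmin (lam : ℝ) (k : ℕ) : ℝ :=
  ∑' d : ℕ, Real.exp (-lam) * lam ^ d / (Nat.factorial d) * min (d : ℝ) (k : ℝ)

noncomputable def pp (lam : ℝ) (d : ℕ) : ℝ := Real.exp (-lam) * lam ^ d / (Nat.factorial d)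

lemma pp_pos {lam : ℝ} (h : 0 < lam) (d : ℕ) : 0 < pp lam d := by
  unfold pp; positivity

lemma pp_succ (lam : ℝ) (d : ℕ) : ((d : ℝ) + 1) * pp lam (d+1) = lam * pp lam d := by
  unfold pp
  rw [Nat.factorial_succ]
  push_cast
  have : (Nat.factorial d : ℝ) ≠ 0 := by positivity
  have : (d : ℝ) + 1 ≠ 0 := by positivity
  field_simp
  ring

lemma exp_hasSum (x : ℝ) : HasSum (fun d : ℕ => x ^ d / (Nat.factorial d : ℝ)) (Real.exp x) := by
  rw [Real.exp_eq_exp_ℝ]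
  exact NormedSpace.expSeries_div_hasSum_exp x

lemma pp_hasSum (lam : ℝ) : HasSum (pp lam) 1 := by
  have h := (exp_hasSum lam).mul_left (Real.exp (-lam))
  rw [← Real.exp_add, neg_add_cancel, Real.exp_zero] at h
  have e : pp lam = fun d : ℕ => Real.exp (-lam) * (lam ^ d / (Nat.factorial d : ℝ)) := by
    funext d
    unfold pp
    ring
  rw [e]
  exact h

lemma sum_d (lam : ℝ) (k : ℕ) :
    ∑ d ∈ Finset.range k, pp lam d * (d : ℝ) = lam * ∑ d ∈ Finset.range k, pp lam d - k * pp lam k := by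
  induction k with
  | zero => simp
  | succ k ih =>
    rw [Finset.sum_range_succ, Finset.sum_range_succ, ih]
    have := pp_succ lam k
    push_cast
    linarith

lemma tail_hasSum (lam : ℝ) (k : ℕ) :
    HasSum (fun d => pp lam (d + k)) (1 - ∑ d ∈ Finset.range k, pp lam d) :=
  (hasSum_nat_add_iff' k).2 (pp_hasSum lam)

lemma emin_eq (lam : ℝ) (k : ℕ) :
    poisEmin lam k = lam * poisCDFlt lam k - k * pp lam k + k * (1 - poisCDFlt lam k) := by
  have h1 : HasSum (fun d : ℕ => pp lam (d + k) * min ((d + k : ℕ) : ℝ) (k : ℝ))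
      ((1 - ∑ d ∈ Finset.range k, pp lam d) * k) := by
    convert! (tail_hasSum lam k).mul_right (k : ℝ) using 1
    funext d
    rw [min_eq_right]
    push_cast
    have : (0 : ℝ) ≤ d := by positivity
    linarith
  have h2 := (hasSum_nat_add_iff (f := fun d : ℕ => pp lam d * min (d : ℝ) (k : ℝ)) k).1 h1
  have h3 : poisEmin lam k = _ := h2.tsum_eq
  have h4 : ∑ d ∈ Finset.range k, pp lam d * min (d : ℝ) (k : ℝ)
      = ∑ d ∈ Finset.range k, pp lam d * (d : ℝ) := by
    apply Finset.sum_congr rfl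
    intro d hd
    rw [min_eq_left]
    exact_mod_cast (Finset.mem_range.1 hd).le
  rw [h3, h4, sum_d]
  show _ = lam * (∑ d ∈ Finset.range k, pp lam d) - k * pp lam k
    + k * (1 - ∑ d ∈ Finset.range k, pp lam d)
  ring

lemma tail_lower {lam : ℝ} (hl : 0 < lam) (k m : ℕ) (hk : 0 < k) (hlk : lam ≤ k) :
    m * (pp lam k * (lam / (k + m)) ^ m) ≤ 1 - poisCDFlt lam k - pp lam k := by
  have hk' : (0 : ℝ) < k := by exact_mod_cast hk
  have hr0 : 0 < lam / ((k : ℝ) + m) := by positivity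
  have hr1 : lam / ((k : ℝ) + m) ≤ 1 := by
    rw [div_le_one (by positivity)]
    have : (0 : ℝ) ≤ m := by positivity
    linarith
  have key : ∀ j : ℕ, j ≤ m → pp lam k * (lam / (k + m)) ^ j ≤ pp lam (k + j) := by
    intro j
    induction j with
    | zero => simp
    | succ j ih =>
      intro hj
      have h1 := ih (by omega)
      have h2 := pp_succ lam (k + j)
      have h3 : pp lam (k + (j + 1)) = lam / ((k + j : ℕ) + 1) * pp lam (k + j) := by
        rw [← add_assoc, div_mul_eq_mul_div, ← h2]
        field_simp
      rw [h3, pow_succ, ← mul_assoc, mul_comm (lam / _) (pp _ _)]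
      have hjm : ((k + j : ℕ) : ℝ) + 1 ≤ k + m := by exact_mod_cast (by omega : k + j + 1 ≤ k + m)
      have := (pp_pos hl (k+j)).le
      gcongr
  have h1 := sum_le_hasSum (Finset.range (m+1)) (fun d _ => (pp_pos hl (d + k)).le) (tail_hasSum lam k)
  rw [Finset.sum_range_succ'] at h1
  have h2 : ∑ j ∈ Finset.range m, pp lam k * (lam / (k + m)) ^ m
      ≤ ∑ j ∈ Finset.range m, pp lam (j + 1 + k) := by
    apply Finset.sum_le_sum
    intro j hj
    have hj := Finset.mem_range.1 hj
    have := key (j+1) (by omega)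
    rw [add_comm (j+1) k]
    refine le_trans ?_ this
    apply mul_le_mul_of_nonneg_left _ (pp_pos hl k).le
    exact pow_le_pow_of_le_one hr0.le hr1 (by omega)
  rw [Finset.sum_const, Finset.card_range, nsmul_eq_mul] at h2
  have h3 : poisCDFlt lam k = ∑ d ∈ Finset.range k, pp lam d := rfl
  rw [h3]
  simp only [zero_add] at h1
  linarith

lemma one_sub_le {x : ℝ} (h0 : 0 ≤ x) (h1 : x < 1) : 1 - x ≤ Real.exp (-x - x^2/2) := by
  have h := Real.hasSum_pow_div_log_of_abs_lt_one (x := x) (by rw [abs_of_nonneg h0]; exact h1)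
  have h2 := sum_le_hasSum (Finset.range 2) (fun d _ => by positivity) h
  norm_num [Finset.sum_range_succ] at h2
  rw [← Real.log_le_iff_le_exp (by linarith)]
  linarith

lemma le_one_sub {x : ℝ} (h0 : 0 ≤ x) (h1 : x ≤ 1/2) : Real.exp (-x - x^2) ≤ 1 - x := by
  have h := Real.quadratic_le_exp_of_nonneg (x := x + x^2) (by positivity)
  have e : -x - x^2 = -(x + x^2) := by ring
  rw [e, Real.exp_neg, inv_le_comm₀ (Real.exp_pos _) (by linarith)]
  refine le_trans ?_ h
  rw [inv_le_iff_one_le_mul₀ (by linarith)]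
  have h3 : 0 ≤ x^2 * (1/2 - x) := by
    apply mul_nonneg (by positivity) (by linarith)
  nlinarith [mul_nonneg h3 h0, mul_nonneg (mul_nonneg h3 h0) h0, mul_nonneg (mul_nonneg (mul_nonneg h3 h0) h0) h0]

/-- Factor `e^{-λ}(λ/k)^k e^k` -/
lemma chernoff {lam : ℝ} (hl : 0 < lam) (k : ℕ) (hk : 0 < k) (hlk : lam ≤ k) :
    1 - poisCDFlt lam k ≤ Real.exp (-lam) * (lam / k) ^ k * Real.exp k := by
  have hk' : (0 : ℝ) < k := by exact_mod_cast hk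
  have hr1 : lam / k ≤ 1 := by rw [div_le_one hk']; exact hlk
  have h1 := (tail_hasSum k k).mul_left (Real.exp (-lam) * (lam / k) ^ k * Real.exp k)
  have h2 := hasSum_le (fun d => ?_) (tail_hasSum lam k) h1
  · refine h2.trans ?_
    apply mul_le_of_le_one_right (by positivity)
    have : 0 ≤ ∑ d ∈ Finset.range k, pp k d := Finset.sum_nonneg fun d _ => (pp_pos hk' d).le
    linarith
  · unfold pp
    have e : Real.exp (-lam) * (lam / k) ^ k * Real.exp k *
        (Real.exp (-(k : ℝ)) * (k:ℝ) ^ (d + k) / ((d + k).factorial : ℝ)) =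
        Real.exp (-lam) * ((lam / k) ^ k * (k:ℝ) ^ (d + k)) / ((d + k).factorial : ℝ) := by
      rw [Real.exp_neg (k : ℝ)]
      field_simp
    rw [e]
    have : lam ^ (d + k) = (lam / k) ^ (d + k) * (k : ℝ)^(d+k) := by
      rw [← mul_pow, div_mul_cancel₀ _ hk'.ne']
    rw [this]
    have := pow_le_pow_of_le_one (by positivity : 0 ≤ lam / k) hr1 (by omega : k ≤ d + k)
    gcongr

lemma fact_upper (k : ℕ) (hk : 0 < k) :
    (k.factorial : ℝ) ≤ Real.exp 1 * √k * (k / Real.exp 1) ^ k := by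
  obtain ⟨n, rfl⟩ : ∃ n, k = n + 1 := ⟨k - 1, by omega⟩
  have h := Stirling.stirlingSeq'_antitone (Nat.zero_le n)
  simp only [Function.comp, Nat.succ_eq_add_one, zero_add, Stirling.stirlingSeq_one] at h
  unfold Stirling.stirlingSeq at h
  rw [div_le_iff₀ (by positivity)] at h
  refine h.trans (le_of_eq ?_)
  rw [Real.sqrt_mul (by norm_num)]
  have : √(2:ℝ) ≠ 0 := by positivity
  field_simp

lemma pp_eq {lam : ℝ} (k : ℕ) (hk : 0 < k) :
    pp lam k = Real.exp (-lam) * (lam / k) ^ k * Real.exp k *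
      ((k / Real.exp 1) ^ k / k.factorial) := by
  have hk' : (0 : ℝ) < k := by exact_mod_cast hk
  unfold pp
  have : Real.exp k = Real.exp 1 ^ k := by rw [← Real.exp_nat_mul, mul_one]
  rw [this, div_pow, div_pow]
  field_simp

set_option maxHeartbeats 2000000 in
/-- Proposition `StaticPolicy`: there exist constants `c, C > 0` and a
threshold `K` such that for every `k ≥ K` and every `λ > 0` with
`P(N_λ ≤ k-1) = E[min{N_λ,k}]/k`, one has
`1 - C·√(log k / k) ≤ P(N_λ ≤ k-1) ≤ 1 - c·√(log k / k)`. -/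
theorem stmt11 :
    ∃ c C : ℝ, 0 < c ∧ 0 < C ∧ ∃ K : ℕ, ∀ k : ℕ, K ≤ k → ∀ lam : ℝ, 0 < lam →
      poisCDFlt lam k = poisEmin lam k / k →
        1 - C * Real.sqrt (Real.log k / k) ≤ poisCDFlt lam k ∧
        poisCDFlt lam k ≤ 1 - c * Real.sqrt (Real.log k / k) := by
  refine ⟨1/8, 2, by norm_num, by norm_num, ⌈Real.exp 16⌉₊, ?_⟩
  intro k hK lam hl heq
  have hKe : Real.exp 16 ≤ k := Nat.ceil_le.1 hK
  have hk' : (0 : ℝ) < k := lt_of_lt_of_le (Real.exp_pos _) hKe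
  have hk : 0 < k := by exact_mod_cast hk'
  have hL : 16 ≤ Real.log k := (Real.le_log_iff_exp_le hk').2 hKe
  have hk16 : (16 : ℝ) ≤ k := by
    have := Real.add_one_le_exp (16 : ℝ)
    linarith
  have hLk : Real.log k ≤ k := by
    have := Real.log_le_sub_one_of_pos hk'
    linarith
  rw [emin_eq, eq_div_iff hk'.ne'] at heq
  set F := poisCDFlt lam k with hF
  have hF0 : 0 ≤ F := Finset.sum_nonneg fun d _ => (pp_pos hl d).le
  have hpk := pp_pos hl k
  -- lam < k
  have hlt : lam < k := by
    by_contra hcon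
    push Not at hcon
    have h1 := sum_le_hasSum (Finset.range 2) (fun d _ => (pp_pos hl (d + k)).le) (tail_hasSum lam k)
    have h2 : pp lam k + pp lam (1 + k) ≤ 1 - F := by
      rw [Finset.sum_range_succ, Finset.sum_range_one, zero_add] at h1
      exact h1
    have h3 := pp_pos hl (1 + k)
    have h4 : 0 < k * (1 - F - pp lam k) := mul_pos hk' (by linarith)
    have h5 : 0 ≤ (lam - k) * F := mul_nonneg (by linarith) hF0
    nlinarith
  set x := 1 - lam / k with hx
  have hlx : lam = k * (1 - x) := by rw [hx]; field_simp; ring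
  have hlx2 : lam / k = 1 - x := by rw [hx]; ring
  have hx0 : 0 < x := by
    have : lam / k < 1 := (div_lt_one hk').2 hlt
    linarith
  have hx1 : x < 1 := by
    have : 0 < lam / k := by positivity
    linarith
  have hid : 1 - F = x * F + pp lam k := by
    apply mul_left_cancel₀ hk'.ne'
    rw [hlx] at heq ⊢
    linear_combination -heq
  have hdelta : x / 2 ≤ 1 - F := by nlinarith
  -- common factor
  set A := Real.exp (-lam) * (lam / k) ^ k * Real.exp k with hA
  have hA' : A = (1 - x)^k * Real.exp (k * x) := by
    rw [hA, hlx2, mul_right_comm, ← Real.exp_add, hlx]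
    rw [mul_comm]; congr 2; ring
  have hA0 : 0 < A := by rw [hA]; positivity
  have hAup : A ≤ Real.exp (-(k * x^2 / 2)) := by
    rw [hA']
    calc (1 - x)^k * Real.exp (k * x) ≤ (Real.exp (-x - x^2/2))^k * Real.exp (k*x) := by
          gcongr
          exact one_sub_le hx0.le hx1
      _ = _ := by
          rw [← Real.exp_nat_mul, ← Real.exp_add]; congr 1; ring
  set S := √(k : ℝ) with hS
  set R := √(Real.log k) with hR
  have hS0 : 0 < S := Real.sqrt_pos.2 hk'
  have hSS : S ^ 2 = k := Real.sq_sqrt hk'.le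
  have hRR : R ^ 2 = Real.log k := Real.sq_sqrt (by linarith)
  have hR4 : 4 ≤ R := by
    rw [hR]; apply Real.le_sqrt_of_sq_le; linarith
  have hSexp : S = Real.exp (R^2 / 2) := by
    rw [hRR, hS, Real.sqrt_eq_rpow, Real.rpow_def_of_pos hk']; congr 1; ring
  have hsq : Real.sqrt (Real.log k / k) = R / S := Real.sqrt_div (by linarith) _
  have hRS : R ≤ S := Real.sqrt_le_sqrt hLk
  rw [hsq]
  set s := S * x with hs
  have hxs : x = s / S := by rw [hs]; field_simp
  have hs0 : 0 < s := by positivity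
  have hkx : k * x^2 = s^2 := by rw [← hSS, hs]; ring
  have hfac : (0 : ℝ) < k.factorial := by positivity
  constructor
  · -- upper bound on delta
    have hch := chernoff hl k hk hlt.le
    have hsR : s ≤ R := by
      by_contra hcon
      push Not at hcon
      have h1 : x / 2 ≤ Real.exp (-(R^2/2)) := by
        refine (hdelta.trans hch).trans (hAup.trans ?_)
        apply Real.exp_le_exp.2
        rw [hkx]
        have h8 : R ^ 2 ≤ s ^ 2 := pow_le_pow_left₀ (by linarith) hcon.le 2
        linarith
      rw [Real.exp_neg, ← hSexp, hxs, div_div, div_le_iff₀ (by positivity)] at h1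
      have : S⁻¹ * (S * 2) = 2 := by field_simp
      linarith
    have hp : pp lam k ≤ 1 / S := by
      rw [pp_eq k hk]
      have hA1 : A ≤ 1 := hAup.trans (Real.exp_le_one_iff.2 (by
        have : 0 ≤ k * x^2 := by positivity
        linarith))
      have hst := Stirling.le_factorial_stirling k
      have hst2 : S ≤ √(2 * Real.pi * k) := by
        apply Real.sqrt_le_sqrt
        exact le_mul_of_one_le_left hk'.le (by linarith [Real.pi_gt_three])
      have h3 : S * (k / Real.exp 1)^k ≤ k.factorial := by
        refine le_trans ?_ hst
        gcongr
      have h4 : ((k / Real.exp 1) ^ k / k.factorial) ≤ 1 / S := by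
        rw [div_le_div_iff₀ hfac hS0]; linarith
      refine le_trans (mul_le_of_le_one_left (by positivity) hA1) h4
    have h5 : 1 - F ≤ s / S + 1 / S := by
      rw [← hxs]
      have : 0 ≤ pp lam k := hpk.le
      have h55 : 0 ≤ x * (1 - F) := mul_nonneg hx0.le (by linarith)
      linarith
    have h6 : s / S + 1 / S ≤ 2 * (R / S) := by
      rw [← add_div, ← mul_div_assoc]
      gcongr
      linarith
    linarith
  · -- lower bound on delta
    have hsR : R / 4 ≤ s := by
      by_contra hcon
      push Not at hcon
      have hxh : x ≤ 1/2 := by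
        rw [hxs, div_le_iff₀ hS0]; linarith
      have hex := le_one_sub hx0.le hxh
      have hAlow : Real.exp (-s^2) ≤ A := by
        rw [hA', ← hkx]
        calc Real.exp (-(k*x^2)) = (Real.exp (-x - x^2))^k * Real.exp (k*x) := by
              rw [← Real.exp_nat_mul, ← Real.exp_add]; congr 1; ring
          _ ≤ _ := by gcongr
      have hplow : Real.exp (-s^2) * (1 / (Real.exp 1 * S)) ≤ pp lam k := by
        rw [pp_eq k hk]
        have h4 : 1 / (Real.exp 1 * S) ≤ ((k / Real.exp 1) ^ k / k.factorial) := by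
          rw [div_le_div_iff₀ (by positivity) hfac]
          have := fact_upper k hk
          linarith
        gcongr
      set m := ⌊S⌋₊ with hm
      have hmS : (m : ℝ) ≤ S := Nat.floor_le hS0.le
      have hmS2 : S / 2 ≤ m := by
        have := Nat.lt_floor_add_one S
        linarith
      have htl := tail_lower hl k m hk hlt.le
      have hxF : 1 - F - pp lam k ≤ x := by
        have h8 : x * F ≤ x * 1 := mul_le_mul_of_nonneg_left (by linarith) hx0.le
        linarith
      have hratio : Real.exp (-(x + x^2 + m / k)) ≤ lam / (k + m) := by
        have e : lam / (k + m) = (1 - x) / (m / k + 1) := by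
          rw [hlx]; field_simp; ring
        rw [e, le_div_iff₀ (by positivity)]
        calc _ ≤ Real.exp (-(x + x^2 + m / k)) * Real.exp (m / k) := by
              gcongr; exact Real.add_one_le_exp _
          _ = Real.exp (-x - x^2) := by rw [← Real.exp_add]; congr 1; ring
          _ ≤ _ := hex
      have hpw : Real.exp (-(1 + 3/2 * s)) ≤ (lam / (k + m))^m := by
        calc _ ≤ (Real.exp (-(x + x^2 + m / k)))^m := by
              rw [← Real.exp_nat_mul]
              apply Real.exp_le_exp.2
              have h1 : m * x ≤ s := by rw [hs]; gcongr
              have h2 : (m : ℝ) * (m / k) ≤ 1 := by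
                rw [← mul_div_assoc, div_le_one hk', ← hSS, sq]; gcongr
              have h3 : m * x * x ≤ s * (1/2) := by gcongr
              have h4 : (m : ℝ) * -(x + x ^ 2 + m / k) = -(m * x + m * x * x + m * (m / k)) := by
                ring
              rw [h4]
              linarith
          _ ≤ _ := by gcongr
      have hall : S / 2 * ((Real.exp (-s^2) * (1 / (Real.exp 1 * S))) * Real.exp (-(1 + 3/2 * s))) ≤ x := by
        refine le_trans ?_ (htl.trans hxF)
        gcongr
      have e1 : S / 2 * ((Real.exp (-s^2) * (1 / (Real.exp 1 * S))) * Real.exp (-(1 + 3/2 * s)))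
          = Real.exp (-(s^2 + 2 + 3/2 * s)) / 2 := by
        have : Real.exp (-(s^2 + 2 + 3/2 * s)) = Real.exp (-s^2) * (Real.exp 1)⁻¹ * Real.exp (-(1 + 3/2 * s)) := by
          rw [← Real.exp_neg, ← Real.exp_add, ← Real.exp_add]; congr 1; ring
        rw [this]; field_simp
      rw [e1, hxs, le_div_iff₀ hS0, hSexp] at hall
      have h7 : Real.exp (-(s^2 + 2 + 3/2 * s)) * Real.exp (R^2/2) ≤ Real.exp (2 * s) := by
        have := Real.add_one_le_exp (2 * s)
        linarith
      rw [← Real.exp_add, Real.exp_le_exp] at h7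
      have h8 : s ^ 2 ≤ (R / 4) ^ 2 := pow_le_pow_left₀ hs0.le hcon.le 2
      have h9 : 4 * R ≤ R ^ 2 := by rw [sq]; gcongr
      linarith
    have : 1/8 * (R / S) ≤ x / 2 := by
      rw [hxs]
      have : R / 4 / S ≤ s / S := by gcongr
      have e : 1/8 * (R/S) = R / 4 / S / 2 := by ring
      linarith
    linarith
end

section
/- Fix integers k ≥ 1 and n > k. Then the infimum over all m ≥ 1 and all IID type distributions G (i.e., type distributions over m types for n agents with G_{ij} = G_j independent of i) of innerLP^{DP/Proph}_{k,n}(G) equals iidLP^{DP/Proph}_{k,n}; and the infimum over all m and IID G of innerLP^{DP/ExAnte}_{k,n}(G) equals iidLP^{DP/ExAnte}_{k,n}. -/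
open Finset

/-- `E[min{Bin(n,q), k}]`. -/
noncomputable def eMinBin (n k : ℕ) (q : ℝ) : ℝ :=
  ∑ d ∈ Finset.range (n+1), (n.choose d : ℝ) * q ^ d * (1-q) ^ (n-d) * min (d : ℝ) (k : ℝ)

/-- The semi-infinite LP `iidLP^{DP/·}_{k,n}` with coefficient function `Q`. -/
noncomputable def iidLP_DP (k n : ℕ) (Q : ℝ → ℝ) : ℝ :=
  sSup {θ : ℝ | ∃ x y, memP k n x y ∧ ∀ q ∈ Set.Ioc (0:ℝ) 1,
    θ * Q q ≤ ∑ i ∈ Finset.Icc 1 n, ∑ l ∈ Finset.Icc 1 k, min (y i l) (q * x i l)}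

/-- An IID type distribution over `m` types: `G 0 = 0 ≤ G 1 ≤ ... ≤ G m = 1`. -/
def IsIIDTypeDist (m : ℕ) (G : ℕ → ℝ) : Prop :=
  G 0 = 0 ∧ G m = 1 ∧ ∀ j ∈ Finset.Icc 1 m, G (j-1) ≤ G j

theorem memP_sum_le {k n : ℕ} (hk : 1 ≤ k) {x y : ℕ → ℕ → ℝ} (h : memP k n x y) :
    ∀ i, 1 ≤ i → i ≤ n → ∑ l ∈ Finset.Icc 1 k, x i l ≤ 1 := by
  obtain ⟨h1, h2, h3, h4⟩ := h
  intro i hi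
  induction i, hi using Nat.le_induction with
  | base =>
    intro _
    rw [Finset.sum_eq_single k]
    · exact h1.le
    · intro b hb hbk
      rw [Finset.mem_Icc] at hb
      exact h2 b hb.1 (by omega)
    · intro hh
      exact absurd (Finset.mem_Icc.2 ⟨hk, le_refl k⟩) hh
  | succ i hi ih =>
    intro hin
    have e : ∑ l ∈ Finset.Icc 1 k, x (i+1) l
        = ∑ l ∈ Finset.Icc 1 k, (x i l - y i l + (if l < k then y i (l+1) else 0)) := by
      apply Finset.sum_congr rfl
      intro l hl
      have := h3 (i+1) (Finset.mem_Icc.2 ⟨by omega, hin⟩) l hl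
      simpa using this
    have key : ∑ l ∈ Finset.Icc 1 k, (if l < k then y i (l+1) else 0)
        ≤ ∑ l ∈ Finset.Icc 1 k, y i l := by
      rw [← Finset.sum_filter]
      have e2 : ∑ l ∈ Finset.Icc 1 k with l < k, y i (l+1)
          = ∑ l ∈ Finset.Icc 2 k, y i l := by
        apply Finset.sum_bij (fun l _ => l + 1)
        · intro a ha
          simp only [Finset.mem_filter, Finset.mem_Icc] at ha ⊢
          omega
        · intro a _ b _ hab
          omega
        · intro b hb
          simp only [Finset.mem_Icc] at hb
          refine ⟨b - 1, ?_, by omega⟩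
          simp only [Finset.mem_filter, Finset.mem_Icc]
          omega
        · intro a _
          rfl
      rw [e2]
      apply Finset.sum_le_sum_of_subset_of_nonneg
      · exact Finset.Icc_subset_Icc (by omega) le_rfl
      · intro l hl _
        exact (h4 i (Finset.mem_Icc.2 ⟨hi, by omega⟩) l hl).1
    rw [e, Finset.sum_add_distrib, Finset.sum_sub_distrib]
    have := ih (by omega)
    linarith

theorem memP_x_bounds {k n : ℕ} (hk : 1 ≤ k) {x y : ℕ → ℕ → ℝ} (h : memP k n x y)
    {i l : ℕ} (hi : i ∈ Finset.Icc 1 n) (hl : l ∈ Finset.Icc 1 k) : 0 ≤ x i l ∧ x i l ≤ 1 := by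
  have hx : ∀ l ∈ Finset.Icc 1 k, 0 ≤ x i l := fun l hl =>
    (h.2.2.2 i hi l hl).1.trans (h.2.2.2 i hi l hl).2
  refine ⟨hx l hl, ?_⟩
  rw [Finset.mem_Icc] at hi
  exact (Finset.single_le_sum hx hl).trans (memP_sum_le hk h i hi.1 hi.2)

/-- The covering function. -/
noncomputable def coverFn (k n : ℕ) (x y : ℕ → ℕ → ℝ) (q : ℝ) : ℝ :=
  ∑ i ∈ Finset.Icc 1 n, ∑ l ∈ Finset.Icc 1 k, min (y i l) (q * x i l)

theorem coverFn_le {k n : ℕ} (hk : 1 ≤ k) {x y : ℕ → ℕ → ℝ} (h : memP k n x y) (q : ℝ) :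
    coverFn k n x y q ≤ n * k := by
  unfold coverFn
  calc _ ≤ ∑ i ∈ Finset.Icc 1 n, ∑ l ∈ Finset.Icc 1 k, (1:ℝ) := by
        apply Finset.sum_le_sum; intro i hi
        apply Finset.sum_le_sum; intro l hl
        exact (min_le_left _ _).trans ((h.2.2.2 i hi l hl).2.trans (memP_x_bounds hk h hi hl).2)
    _ = n * k := by simp

theorem coverFn_zero {k n : ℕ} {x y : ℕ → ℕ → ℝ} (h : memP k n x y) :
    coverFn k n x y 0 = 0 := by
  unfold coverFn
  apply Finset.sum_eq_zero; intro i hi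
  apply Finset.sum_eq_zero; intro l hl
  rw [zero_mul]
  exact min_eq_right (h.2.2.2 i hi l hl).1

theorem coverFn_nonneg {k n : ℕ} (hk : 1 ≤ k) {x y : ℕ → ℕ → ℝ} (h : memP k n x y) {q : ℝ}
    (hq : 0 ≤ q) : 0 ≤ coverFn k n x y q := by
  unfold coverFn
  apply Finset.sum_nonneg; intro i hi
  apply Finset.sum_nonneg; intro l hl
  exact le_min (h.2.2.2 i hi l hl).1 (mul_nonneg hq (memP_x_bounds hk h hi hl).1)

theorem memP_exists (k n : ℕ) : ∃ x y, memP k n x y := by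
  refine ⟨fun _ l => if l = k then 1 else 0, fun _ _ => 0, ?_, ?_, ?_, ?_⟩
  · simp
  · intro l _ hl
    simp [hl.ne]
  · intro i _ l _
    simp
  · intro i _ l _
    refine ⟨le_rfl, ?_⟩
    show (0:ℝ) ≤ if l = k then 1 else 0
    split_ifs <;> norm_num

/-- Restrict a doubly indexed family to the relevant indices. -/
noncomputable def trunc (k n : ℕ) (x : ℕ → ℕ → ℝ) : ℕ → ℕ → ℝ :=
  fun i l => if i ∈ Finset.Icc 1 n ∧ l ∈ Finset.Icc 1 k then x i l else 0

theorem trunc_eq {k n : ℕ} (x : ℕ → ℕ → ℝ) {i l : ℕ} (hi : 1 ≤ i ∧ i ≤ n) (hl : 1 ≤ l ∧ l ≤ k) :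
    trunc k n x i l = x i l := by
  unfold trunc
  rw [if_pos ⟨Finset.mem_Icc.2 hi, Finset.mem_Icc.2 hl⟩]

theorem memP_trunc {k n : ℕ} (hk : 1 ≤ k) (hn : 1 ≤ n) {x y : ℕ → ℕ → ℝ} (h : memP k n x y) :
    memP k n (trunc k n x) (trunc k n y) := by
  obtain ⟨h1, h2, h3, h4⟩ := h
  refine ⟨?_, ?_, ?_, ?_⟩
  · rw [trunc_eq _ ⟨le_rfl, hn⟩ ⟨hk, le_rfl⟩, h1]
  · intro l hl hlk
    rw [trunc_eq _ ⟨le_rfl, hn⟩ ⟨hl, hlk.le⟩, h2 l hl hlk]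
  · intro i hi l hl
    have e := h3 i hi l hl
    rw [Finset.mem_Icc] at hi hl
    rw [trunc_eq _ ⟨by omega, hi.2⟩ hl, trunc_eq _ ⟨by omega, by omega⟩ hl,
      trunc_eq _ ⟨by omega, by omega⟩ hl, e]
    by_cases hlk : l < k
    · rw [if_pos hlk, if_pos hlk, trunc_eq _ ⟨by omega, by omega⟩ ⟨by omega, by omega⟩]
    · rw [if_neg hlk, if_neg hlk]
  · intro i hi l hl
    have e := h4 i hi l hl
    rw [Finset.mem_Icc] at hi hl
    rwa [trunc_eq _ hi hl, trunc_eq _ hi hl]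

theorem coverFn_trunc {k n : ℕ} (x y : ℕ → ℕ → ℝ) (q : ℝ) :
    coverFn k n (trunc k n x) (trunc k n y) q = coverFn k n x y q := by
  unfold coverFn
  apply Finset.sum_congr rfl; intro i hi
  apply Finset.sum_congr rfl; intro l hl
  rw [Finset.mem_Icc] at hi hl
  rw [trunc_eq _ hi hl, trunc_eq _ hi hl]

/-- Compact box containing truncated solutions. -/
def box : Set (ℕ → ℕ → ℝ) := Set.univ.pi fun _ => Set.univ.pi fun _ => Set.Icc (0:ℝ) 1

theorem isCompact_box : IsCompact box :=
  isCompact_univ_pi fun _ => isCompact_univ_pi fun _ => isCompact_Icc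

theorem trunc_mem_box {k n : ℕ} {x : ℕ → ℕ → ℝ}
    (h : ∀ i ∈ Finset.Icc 1 n, ∀ l ∈ Finset.Icc 1 k, 0 ≤ x i l ∧ x i l ≤ 1) :
    trunc k n x ∈ box := by
  intro i _ l _
  unfold trunc
  split_ifs with hh
  · exact h i hh.1 l hh.2
  · simp

theorem isClosed_memP (k n : ℕ) :
    IsClosed {p : (ℕ → ℕ → ℝ) × (ℕ → ℕ → ℝ) | memP k n p.1 p.2} := by
  have cx : ∀ i l, Continuous fun p : (ℕ → ℕ → ℝ) × (ℕ → ℕ → ℝ) => p.1 i l := by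
    intro i l; fun_prop
  have cy : ∀ i l, Continuous fun p : (ℕ → ℕ → ℝ) × (ℕ → ℕ → ℝ) => p.2 i l := by
    intro i l; fun_prop
  unfold memP
  simp only [Set.ofPred_and, Set.ofPred_forall]
  refine IsClosed.inter ?_ (IsClosed.inter ?_ (IsClosed.inter ?_ ?_))
  · exact isClosed_eq (cx _ _) continuous_const
  · exact isClosed_iInter fun l => isClosed_iInter fun _ => isClosed_iInter fun _ =>
      isClosed_eq (cx _ _) continuous_const
  · refine isClosed_iInter fun i => isClosed_iInter fun _ => isClosed_iInter fun l =>
      isClosed_iInter fun _ => isClosed_eq (cx _ _) (((cx _ _).sub (cy _ _)).add ?_)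
    split_ifs
    · exact cy _ _
    · exact continuous_const
  · exact isClosed_iInter fun i => isClosed_iInter fun _ => isClosed_iInter fun l =>
      isClosed_iInter fun _ => (isClosed_le continuous_const (cy _ _)).inter
        (isClosed_le (cy _ _) (cx _ _))

theorem continuous_coverFn (k n : ℕ) (q : ℝ) :
    Continuous fun p : (ℕ → ℕ → ℝ) × (ℕ → ℕ → ℝ) => coverFn k n p.1 p.2 q := by
  unfold coverFn
  fun_prop

theorem exists_grid (S : Finset ℝ) (hS : ∀ q ∈ S, 0 < q ∧ q ≤ 1) :
    ∃ m, 1 ≤ m ∧ ∃ G : ℕ → ℝ, IsIIDTypeDist m G ∧ ∀ q ∈ S, ∃ j ∈ Finset.Icc 1 m, G j = q := by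
  classical
  set T : Finset ℝ := insert 0 (insert 1 S) with hT
  have hb : ∀ q ∈ T, 0 ≤ q ∧ q ≤ 1 := by
    intro q hq
    simp only [hT, Finset.mem_insert] at hq
    rcases hq with rfl | rfl | hq
    · norm_num
    · norm_num
    · exact ⟨(hS q hq).1.le, (hS q hq).2⟩
  have h0 : (0:ℝ) ∈ T := by simp [hT]
  have h1 : (1:ℝ) ∈ T := by simp [hT]
  have hc : 1 < T.card := Finset.one_lt_card.2 ⟨0, h0, 1, h1, by norm_num⟩
  obtain ⟨m, hm⟩ : ∃ m, T.card = m + 1 := ⟨T.card - 1, by omega⟩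
  let e := T.orderEmbOfFin hm
  have hmem : ∀ a, e a ∈ T := fun a => T.orderEmbOfFin_mem hm a
  have hsurj : ∀ q ∈ T, ∃ a, e a = q := by
    intro q hq
    have : q ∈ Set.range (T.orderEmbOfFin hm) := by
      rw [Finset.range_orderEmbOfFin]; exact hq
    exact this
  have e0 : e 0 = 0 := by
    obtain ⟨a, ha⟩ := hsurj 0 h0
    apply le_antisymm _ (hb _ (hmem 0)).1
    rw [← ha]
    exact e.monotone (Fin.zero_le a)
  have e1 : e (Fin.last m) = 1 := by
    obtain ⟨a, ha⟩ := hsurj 1 h1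
    apply le_antisymm (hb _ (hmem _)).2
    rw [← ha]
    exact e.monotone (Fin.le_last a)
  refine ⟨m, by omega, fun j => if h : j < m + 1 then e ⟨j, h⟩ else 1, ⟨?_, ?_, ?_⟩, ?_⟩
  · simpa using e0
  · show (if h : m < m + 1 then e ⟨m, h⟩ else 1) = 1
    rw [dif_pos (Nat.lt_succ_self m)]
    exact e1
  · intro j hj
    rw [Finset.mem_Icc] at hj
    beta_reduce
    rw [dif_pos (show j - 1 < m + 1 by omega), dif_pos (show j < m + 1 by omega)]
    apply e.monotone
    simp
  · intro q hq
    obtain ⟨a, ha⟩ := hsurj q (by simp [hT, hq])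
    refine ⟨a, ?_, ?_⟩
    · rw [Finset.mem_Icc]
      refine ⟨?_, by omega⟩
      by_contra hlt
      have : a = 0 := Fin.ext (by rw [Fin.val_zero]; omega)
      rw [this, e0] at ha
      linarith [(hS q hq).1]
    · beta_reduce
      rw [dif_pos a.2]
      exact ha

theorem typeDist_bounds {m : ℕ} {G : ℕ → ℝ} (h : IsIIDTypeDist m G) :
    ∀ j ≤ m, 0 ≤ G j ∧ G j ≤ 1 := by
  obtain ⟨h0, h1, h2⟩ := h
  intro j hj
  constructor
  · induction j with
    | zero => exact h0.ge
    | succ j ih =>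
      exact (ih (by omega)).trans (h2 (j+1) (Finset.mem_Icc.2 ⟨by omega, hj⟩))
  · rw [← h1]
    have key : ∀ d, d ≤ m → G (m - d) ≤ G m := by
      intro d
      induction d with
      | zero => intro _; exact le_rfl
      | succ d ih =>
        intro hd
        exact (h2 (m - d) (Finset.mem_Icc.2 ⟨by omega, by omega⟩)).trans (ih (by omega))
    have := key (m - j) (by omega)
    rwa [Nat.sub_sub_self hj] at this

theorem generic (k n : ℕ) (hk : 1 ≤ k) (hkn : k < n) (Q : ℝ → ℝ) (hQ0 : Q 0 = 0)
    (hQ : ∀ q, 0 ≤ q → q ≤ 1 → 0 ≤ Q q) (hQ1 : 0 < Q 1) :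
    sInf {v : ℝ | ∃ m, 1 ≤ m ∧ ∃ G : ℕ → ℝ, IsIIDTypeDist m G ∧
        v = innerLP_DP k n m (fun _ j => G j) (fun j => Q (G j))} = iidLP_DP k n Q := by
  have hn : 1 ≤ n := by omega
  set V := {v : ℝ | ∃ m, 1 ≤ m ∧ ∃ G : ℕ → ℝ, IsIIDTypeDist m G ∧
        v = innerLP_DP k n m (fun _ j => G j) (fun j => Q (G j))} with hV
  let A : Set ℝ := {θ : ℝ | ∃ x y, memP k n x y ∧ ∀ q ∈ Set.Ioc (0:ℝ) 1,
    θ * Q q ≤ coverFn k n x y q}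
  let B : ℕ → (ℕ → ℝ) → Set ℝ := fun m G => {θ : ℝ | ∃ x y, memP k n x y ∧
    ∀ j ∈ Finset.Icc 1 m, θ * Q (G j) ≤ coverFn k n x y (G j)}
  have eA : iidLP_DP k n Q = sSup A := rfl
  have eB : ∀ m G, innerLP_DP k n m (fun _ j => G j) (fun j => Q (G j)) = sSup (B m G) :=
    fun m G => rfl
  rw [eA]
  have bound : ∀ θ x y, memP k n x y → θ * Q 1 ≤ coverFn k n x y 1 → θ ≤ n * k / Q 1 := by
    intro θ x y h hθ
    rw [le_div_iff₀ hQ1]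
    exact hθ.trans (coverFn_le hk h 1)
  have bA : BddAbove A := by
    refine ⟨n * k / Q 1, ?_⟩
    rintro θ ⟨x, y, h, hθ⟩
    exact bound θ x y h (hθ 1 (by norm_num))
  have bB : ∀ m G, 1 ≤ m → IsIIDTypeDist m G → BddAbove (B m G) := by
    intro m G hm hG
    refine ⟨n * k / Q 1, ?_⟩
    rintro θ ⟨x, y, h, hθ⟩
    have := hθ m (Finset.mem_Icc.2 ⟨hm, le_rfl⟩)
    rw [hG.2.1] at this
    exact bound θ x y h this
  have neA : A.Nonempty := by
    obtain ⟨x, y, h⟩ := memP_exists k n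
    refine ⟨0, x, y, h, fun q hq => ?_⟩
    rw [zero_mul]
    exact coverFn_nonneg hk h hq.1.le
  have AB : ∀ m G, IsIIDTypeDist m G → A ⊆ B m G := by
    rintro m G hG θ ⟨x, y, h, hθ⟩
    refine ⟨x, y, h, fun j hj => ?_⟩
    obtain ⟨g0, g1⟩ := typeDist_bounds hG j (Finset.mem_Icc.1 hj).2
    rcases g0.eq_or_lt with g | g
    · rw [← g, hQ0, mul_zero, coverFn_zero h]
    · exact hθ _ ⟨g, g1⟩
  have neB : ∀ m G, IsIIDTypeDist m G → (B m G).Nonempty := fun m G hG => neA.mono (AB m G hG)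
  have neV : V.Nonempty := by
    obtain ⟨m, hm, G, hG, -⟩ := exists_grid ∅ (by simp)
    exact ⟨_, m, hm, G, hG, rfl⟩
  have lbV : sSup A ∈ lowerBounds V := by
    rintro v ⟨m, hm, G, hG, rfl⟩
    rw [eB]
    exact csSup_le_csSup (bB m G hm hG) neA (AB m G hG)
  refine le_antisymm ?_ (le_csInf neV lbV)
  by_contra hlt
  rw [not_le] at hlt
  obtain ⟨θ, hθ1, hθ2⟩ := exists_between hlt
  suffices hθ : θ ∈ A from absurd (le_csSup bA hθ) (not_le.2 hθ1)
  let K : Set ((ℕ → ℕ → ℝ) × (ℕ → ℕ → ℝ)) := (box ×ˢ box) ∩ {p | memP k n p.1 p.2}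
  have hK : IsCompact K := (isCompact_box.prod isCompact_box).inter_right (isClosed_memP k n)
  let C : Set.Ioc (0:ℝ) 1 → Set ((ℕ → ℕ → ℝ) × (ℕ → ℕ → ℝ)) :=
    fun q => {p | θ * Q q ≤ coverFn k n p.1 p.2 q}
  have hC : ∀ q, IsClosed (C q) := fun q =>
    isClosed_le continuous_const (continuous_coverFn k n q)
  have main : (K ∩ ⋂ q, C q).Nonempty := by
    apply hK.inter_iInter_nonempty C hC
    intro u
    obtain ⟨m, hm, G, hG, hSG⟩ := exists_grid (u.map (Function.Embedding.subtype _)) (by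
      intro q hq
      rw [Finset.mem_map] at hq
      obtain ⟨a, -, rfl⟩ := hq
      exact a.2)
    have hlt2 : θ < sSup (B m G) := hθ2.trans_le (csInf_le ⟨_, lbV⟩ ⟨m, hm, G, hG, eB m G⟩)
    obtain ⟨θ', ⟨x, y, h, hθ'⟩, hlt3⟩ := exists_lt_of_lt_csSup (neB m G hG) hlt2
    refine ⟨(trunc k n x, trunc k n y), ⟨⟨?_, ?_⟩, memP_trunc hk hn h⟩, ?_⟩
    · exact trunc_mem_box fun i hi l hl => memP_x_bounds hk h hi hl
    · exact trunc_mem_box fun i hi l hl => ⟨(h.2.2.2 i hi l hl).1,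
        (h.2.2.2 i hi l hl).2.trans (memP_x_bounds hk h hi hl).2⟩
    · simp only [Set.mem_iInter]
      intro q hq
      obtain ⟨j, hj, hjq⟩ := hSG q (by
        rw [Finset.mem_map]
        exact ⟨q, hq, rfl⟩)
      show θ * Q q ≤ coverFn k n (trunc k n x) (trunc k n y) q
      rw [coverFn_trunc]
      have h2 := hθ' j hj
      rw [hjq] at h2
      exact (mul_le_mul_of_nonneg_right hlt3.le (hQ q q.2.1.le q.2.2)).trans h2
  obtain ⟨p, hp1, hp2⟩ := main
  rw [Set.mem_iInter] at hp2
  exact ⟨p.1, p.2, hp1.2, fun q hq => hp2 ⟨q, hq⟩⟩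

theorem eMinBer_const (n k : ℕ) (q : ℝ) : eMinBer (fun _ => q) n k = eMinBin n k q := by
  unfold eMinBer eMinBin
  have h := Finset.sum_powerset_apply_card (x := Finset.Icc 1 n)
    (fun d => q ^ d * (1 - q) ^ (n - d) * min (d : ℝ) (k : ℝ))
  rw [Nat.card_Icc, Nat.add_sub_cancel] at h
  calc _ = ∑ S ∈ (Finset.Icc 1 n).powerset,
        q ^ S.card * (1 - q) ^ (n - S.card) * min (S.card : ℝ) (k : ℝ) := by
        apply Finset.sum_congr rfl
        intro S hS
        rw [Finset.mem_powerset] at hS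
        rw [Finset.prod_const, Finset.prod_const, Finset.card_sdiff_of_subset hS, Nat.card_Icc,
          Nat.add_sub_cancel]
    _ = _ := by
        rw [h]
        apply Finset.sum_congr rfl
        intro d _
        rw [nsmul_eq_mul]
        ring

theorem stmt13 (k n : ℕ) (hk : 1 ≤ k) (hkn : k < n) :
    (sInf {v : ℝ | ∃ m, 1 ≤ m ∧ ∃ G : ℕ → ℝ, IsIIDTypeDist m G ∧
        v = innerLP_DP k n m (fun _ j => G j) (QProph k n (fun _ j => G j))}
      = iidLP_DP k n (fun q => eMinBin n k q)) ∧
    (sInf {v : ℝ | ∃ m, 1 ≤ m ∧ ∃ G : ℕ → ℝ, IsIIDTypeDist m G ∧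
        v = innerLP_DP k n m (fun _ j => G j) (QExAnte k n (fun _ j => G j))}
      = iidLP_DP k n (fun q => min ((n : ℝ) * q) (k : ℝ))) := by
  have hk' : (0:ℝ) < k := by exact_mod_cast hk
  have hn' : (0:ℝ) < n := by exact_mod_cast (show 0 < n by omega)
  constructor
  · rw [← generic k n hk hkn (fun q => eMinBin n k q)]
    · have e : ∀ G : ℕ → ℝ, QProph k n (fun _ j => G j) = fun j => eMinBin n k (G j) := by
        intro G
        funext j
        exact eMinBer_const n k (G j)
      simp only [e]
    · show eMinBin n k 0 = 0
      unfold eMinBin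
      apply Finset.sum_eq_zero
      intro d _
      rcases Nat.eq_zero_or_pos d with rfl | hd
      · simp
      · simp [zero_pow hd.ne']
    · intro q h0 h1
      apply Finset.sum_nonneg
      intro d _
      have : 0 ≤ 1 - q := by linarith
      positivity
    · show 0 < eMinBin n k 1
      unfold eMinBin
      rw [Finset.sum_eq_single n]
      · simp [hk', hn']
      · intro d hd hdn
        rw [Finset.mem_range] at hd
        rw [sub_self, zero_pow (by omega)]
        simp
      · simp
  · rw [← generic k n hk hkn (fun q => min ((n : ℝ) * q) (k : ℝ))]
    · have e : ∀ G : ℕ → ℝ, QExAnte k n (fun _ j => G j)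
          = fun j => min ((n : ℝ) * G j) (k : ℝ) := by
        intro G
        funext j
        simp [QExAnte]
      simp only [e]
    · simp
    · intro q h0 h1
      positivity
    · simp [hk', hn']
end
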